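/- Let $\mathcal V,\mathcal X,\mathcal Y$ be finite alphabets ($\mathcal X$ nonempty), $P_V$ a probability distribution on $\mathcal V$ with product extension $P^k$, $W(y|x)$ a discrete memoryless channel with product extension $W^n$, and $t>0$. Logarithms are natural, $H$ is entropy, $D$ is Kullback–Leibler divergence ($D(Q\|P)=+\infty$ unless $Q\ll P$), and minima over empty sets are $+\infty$. Put $e(R,P_V)=\min_{Q:\,H(Q)\ge R}D(Q\|P_V)$ and $d_B(x,\bar x)=-\log\sum_y\sqrt{W(y|x)W(y|\bar x)}\in[0,+\infty]$. For a probability distribution $Q$ on $\mathcal X$ and $R\ge 0$ put $$E'_{\mathrm{ex}}(Q,R)=\min_{P_{X\bar X}:\;P_X=Q,\; I_P(X;\bar X)\le R}\ \mathbb E_P[d_B(X,\bar X)]+I_P(X;\bar X)-R,$$ where $0\cdot\infty=0$. Let $$E^{\mathrm{ex}}_{J,2}(t,P_V)=\min_{R\ge 0}\Big[t\,e(R/t,P_V)+\sup_Q E'_{\mathrm{ex}}(Q,R)\Big]\in(-\infty,+\infty],$$ the supremum being over all probability distributions $Q$ on $\mathcal X$, be Csiszár's second expurgated joint source-channel exponent.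 The type of a sequence is its empirical distribution, and $\mathcal T^n(Q)$ is the set of sequences in $\mathcal X^n$ of type $Q$. The exponent $E^{\mathrm{ex}}_{J,2}(t,P_V)$ is achievable with only two classes of source sequences: there exist probability distributions $Q_1,Q_2$ on $\mathcal X$ such that for every $\varepsilon>0$ and all sufficiently large $n$, with $k=\lfloor tn\rfloor$, there are * a partition $\mathcal V^k=\mathcal A_1\cup\mathcal A_2$ into two disjoint classes, each a union of source type classes (both nonempty if $|\mathcal V|\ge 2$; if $|\mathcal V|=1$ there is only one type class and one of them is empty); * types $Q_1^{(n)},Q_2^{(n)}$ of sequences in $\mathcal X^n$ with $|Q_c^{(n)}(x)-Q_c(x)|\le\varepsilon$ for all $x\in\mathcal X$ and $c=1,2$; * an encoder $f:\mathcal V^k\to\mathcal X^n$ with $f(v)\in\mathcal T^n(Q_c^{(n)})$ for every $v\in\mathcal A_c$, $c=1,2$, and a decoder $\varphi:\mathcal Y^n\to\mathcal V^k$, whose error probability $p_e=\sum_{v}P^k(v)\sum_{y:\,\varphi(y)\ne v}W^n(y|f(v))$ satisfies $$p_e\le\exp\!\big(-n\,(E^{\mathrm{ex}}_{J,2}(t,P_V)-\varepsilon)\big),$$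 where the right-hand side is $0$ if $E^{\mathrm{ex}}_{J,2}(t,P_V)=+\infty$. -/

import Mathlib

noncomputable section

open scoped Classical BigOperators

/-- `W` is a discrete memoryless channel: every row is a probability distribution. -/
def IsDMC {X Y : Type*} [Fintype Y] (W : X → Y → ℝ) : Prop :=
  ∀ x, W x ∈ stdSimplex ℝ Y

/-- Product extension of a distribution: `P^k(v) = ∏ P(vᵢ)`. -/
def prodDist {α : Type*} (P : α → ℝ) {k : ℕ} (v : Fin k → α) : ℝ := ∏ i, P (v i)

/-- Product extension of a channel: `W^n(y|x) = ∏ W(y_l|x_l)`. -/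
def Wn {X Y : Type*} (W : X → Y → ℝ) {n : ℕ} (x : Fin n → X) (y : Fin n → Y) : ℝ :=
  ∏ l, W (x l) (y l)

/-- Shannon entropy (natural logarithm, `0 log 0 = 0`). -/
def entH {α : Type*} [Fintype α] (P : α → ℝ) : ℝ := -∑ a, P a * Real.log (P a)

/-- Kullback–Leibler divergence `D(Q‖P)`, equal to `+∞` unless `Q ≪ P`. -/
def KL {α : Type*} [Fintype α] (Q P : α → ℝ) : EReal :=
  if ∀ a, P a = 0 → Q a = 0 then ((∑ a, Q a * Real.log (Q a / P a) : ℝ) : EReal) else ⊤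

/-- Source reliability function `e(R, P_V) = min_{Q : H(Q) ≥ R} D(Q‖P_V)`
(`+∞` if no distribution has entropy at least `R`). -/
def srcRel {V : Type*} [Fintype V] (PV : V → ℝ) (R : ℝ) : EReal :=
  sInf { z | ∃ Q ∈ stdSimplex ℝ V, R ≤ entH Q ∧ z = KL Q PV }

/-- Bhattacharyya distance, equal to `+∞` if the two output distributions have
disjoint supports. -/
def dB {X Y : Type*} [Fintype Y] (W : X → Y → ℝ) (x x' : X) : EReal :=
  if ∑ y, Real.sqrt (W x y * W x' y) = 0 then ⊤
  else ((-Real.log (∑ y, Real.sqrt (W x y * W x' y)) : ℝ) : EReal)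

/-- Mutual information of a joint distribution on `X × X`. -/
def mutualInfo {X : Type*} [Fintype X] (P : X × X → ℝ) : ℝ :=
  ∑ p : X × X, P p * Real.log (P p / ((∑ x', P (p.1, x')) * (∑ x, P (x, p.2))))

/-- Expected Bhattacharyya distance `𝔼_P[d_B(X, X̄)]` (with `0 · ∞ = 0`, as in `EReal`). -/
def expDB {X Y : Type*} [Fintype X] [Fintype Y] (W : X → Y → ℝ) (P : X × X → ℝ) : EReal :=
  ∑ p : X × X, (P p : EReal) * dB W p.1 p.2

/-- Weak expurgated exponent: the minimum of `𝔼_P[d_B(X, X̄)] + I_P(X; X̄) - R` over joint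
distributions `P` with first marginal `Q` and `I_P(X; X̄) ≤ R`. -/
def Eex' {X Y : Type*} [Fintype X] [Fintype Y] (W : X → Y → ℝ) (Q : X → ℝ) (R : ℝ) : EReal :=
  sInf { z | ∃ P ∈ stdSimplex ℝ (X × X), (∀ x, ∑ x', P (x, x') = Q x) ∧
    mutualInfo P ≤ R ∧ z = expDB W P + ((mutualInfo P - R : ℝ) : EReal) }

/-- Csiszár's second expurgated joint source-channel exponent
`E^ex_{J,2}(t, P_V) = min_{R ≥ 0} [t e(R/t, P_V) + max_Q E'_ex(Q, R)]`. -/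
def EJ2ex {V X Y : Type*} [Fintype V] [Fintype X] [Fintype Y]
    (PV : V → ℝ) (W : X → Y → ℝ) (t : ℝ) : EReal :=
  sInf { z | ∃ R : ℝ, 0 ≤ R ∧
    z = (t : EReal) * srcRel PV (R / t) +
      sSup { w | ∃ Q ∈ stdSimplex ℝ X, w = Eex' W Q R } }

/-- Empirical distribution (type) of a sequence. -/
def empDist {α : Type*} {k : ℕ} (v : Fin k → α) : α → ℝ :=
  fun a => ((Finset.univ.filter fun i => v i = a).card : ℝ) / k

/-- Type class `T^n(Q)`: sequences of length `n` with empirical distribution `Q`. -/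
def typeClass {α : Type*} (n : ℕ) (Q : α → ℝ) : Set (Fin n → α) :=
  { x | empDist x = Q }

/-- Error probability of a joint source-channel code `(f, φ)`. -/
def pErr {V X Y : Type*} [Fintype V] [Fintype Y] (PV : V → ℝ)
    (W : X → Y → ℝ) {k n : ℕ}
    (f : (Fin k → V) → Fin n → X) (φ : (Fin n → Y) → Fin k → V) : ℝ :=
  ∑ v : Fin k → V, prodDist PV v *
    ∑ y ∈ Finset.univ.filter (fun y : Fin n → Y => φ y ≠ v), Wn W (f v) y

/-- `cls` describes a partition of `V^k` into `m` (labelled) classes, each of which is a union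
of source type classes; every class is nonempty, except that over a one-letter
alphabet, where `V^k` is a single type class, only the union property is asked for. -/
def IsTypePartition {V : Type*} {k m : ℕ} (cls : (Fin k → V) → Fin m) : Prop :=
  (∀ v v' : Fin k → V, empDist v = empDist v' → cls v = cls v') ∧
  (Nontrivial V → Function.Surjective cls)

end

noncomputable section

open scoped Classical BigOperators
open Filter

section Entropy

variable {α : Type*} [Fintype α]

lemma entH_eq_sum_negMulLog (P : α → ℝ) : entH P = ∑ a, Real.negMulLog (P a) := by
  simp [entH, Real.negMulLog, Finset.sum_neg_distrib]

lemma continuous_entH : Continuous (entH : (α → ℝ) → ℝ) := by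
  have : (entH : (α → ℝ) → ℝ) = fun P => ∑ a, Real.negMulLog (P a) :=
    funext entH_eq_sum_negMulLog
  rw [this]
  exact continuous_finsetSum _ fun a _ => Real.continuous_negMulLog.comp (continuous_apply a)

lemma entH_nonneg {P : α → ℝ} (hP : P ∈ stdSimplex ℝ α) : 0 ≤ entH P := by
  rw [entH_eq_sum_negMulLog]
  refine Finset.sum_nonneg fun a _ => Real.negMulLog_nonneg (hP.1 a) ?_
  rw [← hP.2]
  exact Finset.single_le_sum (fun i _ => hP.1 i) (Finset.mem_univ a)

lemma concaveOn_entH : ConcaveOn ℝ (stdSimplex ℝ α) (entH : (α → ℝ) → ℝ) := by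
  refine ⟨convex_stdSimplex ℝ α, fun P hP Q hQ a b ha hb hab => ?_⟩
  simp only [entH_eq_sum_negMulLog, smul_eq_mul, Finset.mul_sum, ← Finset.sum_add_distrib]
  exact Finset.sum_le_sum fun x _ => Real.concaveOn_negMulLog.2 (hP.1 x) (hQ.1 x) ha hb hab

/-- Two-term log-sum inequality. -/
lemma log_sum_two {a b c d : ℝ} (ha : 0 ≤ a) (hb : 0 ≤ b) (hc : 0 ≤ c) (hd : 0 ≤ d)
    (hac : c = 0 → a = 0) (hbd : d = 0 → b = 0) :
    (a + b) * Real.log ((a + b) / (c + d)) ≤ a * Real.log (a / c) + b * Real.log (b / d) := by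
  rcases hc.eq_or_lt with rfl | hc'
  · simp [hac rfl]
  rcases hd.eq_or_lt with rfl | hd'
  · simp [hbd rfl]
  rcases (add_nonneg ha hb).eq_or_lt with h0 | h0
  · have h1 : a = 0 := by linarith
    have h2 : b = 0 := by linarith
    simp [h1, h2]
  have key : ∀ u w : ℝ, 0 ≤ u → 0 < w →
      u * Real.log ((a + b) / (c + d)) + (u - w * ((a + b) / (c + d))) ≤ u * Real.log (u / w) := by
    intro u w hu hw
    rcases hu.eq_or_lt with rfl | hu'
    · simp; positivity
    have hs : 0 < (a + b) / (c + d) := by positivity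
    have h := Real.log_le_sub_one_of_pos (x := w * ((a + b) / (c + d)) / u) (by positivity)
    rw [Real.log_div (by positivity) hu'.ne', Real.log_mul hw.ne' hs.ne'] at h
    rw [Real.log_div hu'.ne' hw.ne']
    have h2 := mul_le_mul_of_nonneg_left h hu'.le
    have h3 : u * (w * ((a + b) / (c + d)) / u - 1) = w * ((a + b) / (c + d)) - u := by
      field_simp
    rw [h3] at h2
    linarith
  have h1 := key a c ha hc'
  have h2 := key b d hb hd'
  have h3 : c * ((a + b) / (c + d)) + d * ((a + b) / (c + d)) = a + b := by field_simp
  linarith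

end Entropy

section MutualInfo

variable {X : Type*} [Fintype X]

lemma le_marginal_fst {P : X × X → ℝ} (hP : ∀ p, 0 ≤ P p) (p : X × X) :
    P p ≤ ∑ x', P (p.1, x') :=
  Finset.single_le_sum (f := fun x' => P (p.1, x')) (fun _ _ => hP _) (Finset.mem_univ p.2)

lemma le_marginal_snd {P : X × X → ℝ} (hP : ∀ p, 0 ≤ P p) (p : X × X) :
    P p ≤ ∑ x, P (x, p.2) :=
  Finset.single_le_sum (f := fun x => P (x, p.2)) (fun _ _ => hP _) (Finset.mem_univ p.1)

lemma mutualInfo_eq_entropies {P : X × X → ℝ} (hP : ∀ p, 0 ≤ P p) :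
    mutualInfo P = entH (fun x => ∑ x', P (x, x')) + entH (fun x' => ∑ x, P (x, x')) - entH P := by
  have h1 : ∑ p : X × X, P p * Real.log (∑ x', P (p.1, x'))
      = ∑ x, (∑ x', P (x, x')) * Real.log (∑ x', P (x, x')) := by
    rw [Fintype.sum_prod_type]
    simp only [Finset.sum_mul]
  have h2 : ∑ p : X × X, P p * Real.log (∑ x, P (x, p.2))
      = ∑ x', (∑ x, P (x, x')) * Real.log (∑ x, P (x, x')) := by
    rw [Fintype.sum_prod_type_right]
    simp only [Finset.sum_mul]
  simp only [entH]
  rw [← h1, ← h2, mutualInfo]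
  have : ∀ p : X × X, P p * Real.log (P p / ((∑ x', P (p.1, x')) * ∑ x, P (x, p.2)))
      = P p * Real.log (P p) - P p * Real.log (∑ x', P (p.1, x'))
        - P p * Real.log (∑ x, P (x, p.2)) := by
    intro p
    rcases (hP p).eq_or_lt with h | h
    · simp [← h]
    · have ha := h.trans_le (le_marginal_fst hP p)
      have hb := h.trans_le (le_marginal_snd hP p)
      rw [Real.log_div h.ne' (by positivity), Real.log_mul ha.ne' hb.ne']
      ring
  rw [Finset.sum_congr rfl fun p _ => this p, Finset.sum_sub_distrib, Finset.sum_sub_distrib]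
  ring

lemma continuousOn_mutualInfo :
    ContinuousOn (mutualInfo : (X × X → ℝ) → ℝ) (stdSimplex ℝ (X × X)) := by
  have h : Continuous fun P : X × X → ℝ =>
      entH (fun x => ∑ x', P (x, x')) + entH (fun x' => ∑ x, P (x, x')) - entH P := by
    refine ((continuous_entH.comp ?_).add (continuous_entH.comp ?_)).sub continuous_entH
    · exact continuous_pi fun x => continuous_finsetSum _ fun x' _ => continuous_apply _
    · exact continuous_pi fun x => continuous_finsetSum _ fun x' _ => continuous_apply _
  exact h.continuousOn.congr fun P hP => mutualInfo_eq_entropies hP.1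

/-- Couplings with a prescribed first marginal. -/
def fstMarginalSet (Q : X → ℝ) : Set (X × X → ℝ) :=
  {P | P ∈ stdSimplex ℝ (X × X) ∧ ∀ x, ∑ x', P (x, x') = Q x}

lemma convex_fstMarginalSet (Q : X → ℝ) : Convex ℝ (fstMarginalSet Q) := by
  intro P hP P' hP' a b ha hb hab
  refine ⟨convex_stdSimplex ℝ _ hP.1 hP'.1 ha hb hab, fun x => ?_⟩
  simp only [Pi.add_apply, Pi.smul_apply, smul_eq_mul, Finset.sum_add_distrib, ← Finset.mul_sum,
    hP.2, hP'.2]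
  rw [← add_mul, hab, one_mul]

lemma convexOn_mutualInfo (Q : X → ℝ) :
    ConvexOn ℝ (fstMarginalSet Q) (mutualInfo : (X × X → ℝ) → ℝ) := by
  refine ⟨convex_fstMarginalSet Q, fun P hP P' hP' a b ha hb hab => ?_⟩
  rw [mutualInfo, mutualInfo, mutualInfo, smul_eq_mul, smul_eq_mul, Finset.mul_sum,
    Finset.mul_sum, ← Finset.sum_add_distrib]
  refine Finset.sum_le_sum fun p _ => ?_
  have hmar := (convex_fstMarginalSet Q hP hP' ha hb hab).2 p.1
  rw [hmar, hP.2, hP'.2]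
  have hsnd : ∑ x, (a • P + b • P') (x, p.2) = a * ∑ x, P (x, p.2) + b * ∑ x, P' (x, p.2) := by
    simp only [Pi.add_apply, Pi.smul_apply, smul_eq_mul, Finset.sum_add_distrib, ← Finset.mul_sum]
  rw [hsnd]
  have scale : ∀ (s u w : ℝ), s * u * Real.log (s * u / (s * w)) = s * (u * Real.log (u / w)) := by
    intro s u w
    rcases eq_or_ne s 0 with rfl | hs
    · simp
    · rw [mul_div_mul_left _ _ hs]; ring
  have hz : ∀ (s : ℝ) (R : X × X → ℝ), R ∈ fstMarginalSet Q →
      s * (Q p.1 * ∑ x, R (x, p.2)) = 0 → s * R p = 0 := by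
    intro s R hR h
    rcases mul_eq_zero.1 h with h | h
    · simp [h]
    rcases mul_eq_zero.1 h with h | h
    · have := le_marginal_fst hR.1.1 p
      rw [hR.2, h] at this
      simp [le_antisymm this (hR.1.1 p)]
    · have := le_marginal_snd hR.1.1 p
      rw [h] at this
      simp [le_antisymm this (hR.1.1 p)]
  have hQ : 0 ≤ Q p.1 := by rw [← hP.2]; exact Finset.sum_nonneg fun i _ => hP.1.1 _
  have hsn : ∀ R ∈ fstMarginalSet Q, 0 ≤ ∑ x, R (x, p.2) := fun R hR =>
    Finset.sum_nonneg fun i _ => hR.1.1 _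
  have h := log_sum_two (mul_nonneg ha (hP.1.1 p)) (mul_nonneg hb (hP'.1.1 p))
    (mul_nonneg ha (mul_nonneg hQ (hsn P hP))) (mul_nonneg hb (mul_nonneg hQ (hsn P' hP')))
    (hz a P hP) (hz b P' hP')
  rw [scale, scale] at h
  refine le_trans (le_of_eq ?_) h
  simp only [Pi.add_apply, Pi.smul_apply, smul_eq_mul]
  congr 3
  ring

/-- Mutual information is the smallest divergence from a product with the given first marginal. -/
lemma mutualInfo_le_divergence {P : X × X → ℝ} (hP : P ∈ stdSimplex ℝ (X × X)) {Q Q' : X → ℝ}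
    (hQ : ∀ x, ∑ x', P (x, x') = Q x) (hQ' : Q' ∈ stdSimplex ℝ X)
    (hac : ∀ p, Q' p.2 = 0 → P p = 0) :
    mutualInfo P ≤ ∑ p : X × X, P p * Real.log (P p / (Q p.1 * Q' p.2)) := by
  have key : ∀ p : X × X, P p * Real.log (P p / ((∑ x', P (p.1, x')) * ∑ x, P (x, p.2)))
      ≤ P p * Real.log (P p / (Q p.1 * Q' p.2)) +
        (P p * (Q' p.2 / ∑ x, P (x, p.2)) - P p) := by
    intro p
    rcases (hP.1 p).eq_or_lt with h | h
    · simp [← h]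
    have ha := h.trans_le (le_marginal_fst hP.1 p)
    have hb := h.trans_le (le_marginal_snd hP.1 p)
    have hq : 0 < Q' p.2 := (hQ'.1 _).lt_of_ne fun h0 => h.ne' (hac p h0.symm)
    have hl := Real.log_le_sub_one_of_pos (div_pos hq hb)
    rw [Real.log_div hq.ne' hb.ne'] at hl
    rw [hQ] at ha ⊢
    rw [Real.log_div h.ne' (by positivity), Real.log_div h.ne' (by positivity),
      Real.log_mul ha.ne' hb.ne', Real.log_mul ha.ne' hq.ne']
    nlinarith [mul_le_mul_of_nonneg_left hl h.le]
  refine (Finset.sum_le_sum fun p _ => key p).trans ?_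
  rw [Finset.sum_add_distrib, Finset.sum_sub_distrib, hP.2]
  have : ∑ p : X × X, P p * (Q' p.2 / ∑ x, P (x, p.2)) ≤ 1 := by
    rw [Fintype.sum_prod_type_right, ← hQ'.2]
    refine Finset.sum_le_sum fun b _ => ?_
    simp only [← Finset.sum_mul]
    rcases eq_or_ne (∑ x, P (x, b)) 0 with h | h
    · simp [h, hQ'.1 b]
    · rw [mul_div_cancel₀ _ h]
  linarith

end MutualInfo

section Bhattacharyya

variable {X Y : Type*} [Fintype X] [Fintype Y]

/-- Bhattacharyya coefficient of two rows of a channel. -/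
def bhatt (W : X → Y → ℝ) (x x' : X) : ℝ := ∑ y, Real.sqrt (W x y * W x' y)

omit [Fintype X] in
lemma bhatt_nonneg (W : X → Y → ℝ) (x x' : X) : 0 ≤ bhatt W x x' :=
  Finset.sum_nonneg fun _ _ => Real.sqrt_nonneg _

omit [Fintype X] in
lemma bhatt_symm (W : X → Y → ℝ) (x x' : X) : bhatt W x x' = bhatt W x' x := by
  simp [bhatt, mul_comm]

omit [Fintype X] in
lemma bhatt_le_one {W : X → Y → ℝ} (hW : IsDMC W) (x x' : X) : bhatt W x x' ≤ 1 := by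
  have h : ∀ y, Real.sqrt (W x y * W x' y) ≤ (W x y + W x' y) / 2 := by
    intro y
    rw [Real.sqrt_le_left (by linarith [(hW x).1 y, (hW x').1 y])]
    nlinarith [sq_nonneg (W x y - W x' y)]
  refine (Finset.sum_le_sum fun y _ => h y).trans (le_of_eq ?_)
  rw [← Finset.sum_div, Finset.sum_add_distrib, (hW x).2, (hW x').2]
  norm_num

/-- Couplings under which the Bhattacharyya distance is almost surely finite. -/
def finiteDistSet (W : X → Y → ℝ) : Set (X × X → ℝ) :=
  {P | P ∈ stdSimplex ℝ (X × X) ∧ ∀ p, bhatt W p.1 p.2 = 0 → P p = 0}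

lemma isCompact_finiteDistSet (W : X → Y → ℝ) : IsCompact (finiteDistSet W) := by
  refine (isCompact_stdSimplex ℝ (X × X)).inter_right
    (t := {P | ∀ p, bhatt W p.1 p.2 = 0 → P p = 0}) ?_
  simp only [Set.ofPred_forall]
  exact isClosed_iInter fun p => isClosed_iInter fun _ =>
    isClosed_eq (continuous_apply p) continuous_const

lemma convex_finiteDistSet (W : X → Y → ℝ) : Convex ℝ (finiteDistSet W) := by
  intro P hP P' hP' a b ha hb hab
  refine ⟨convex_stdSimplex ℝ _ hP.1 hP'.1 ha hb hab, fun p hp => ?_⟩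
  simp [hP.2 p hp, hP'.2 p hp]

/-- Expected Bhattacharyya distance, for couplings under which it is finite. -/
def meanDist (W : X → Y → ℝ) (P : X × X → ℝ) : ℝ :=
  ∑ p : X × X, P p * -Real.log (bhatt W p.1 p.2)

lemma continuous_meanDist (W : X → Y → ℝ) : Continuous (meanDist W) :=
  continuous_finsetSum _ fun p _ => (continuous_apply p).mul continuous_const

lemma meanDist_combo (W : X → Y → ℝ) (a b : ℝ) (P P' : X × X → ℝ) :
    meanDist W (a • P + b • P') = a * meanDist W P + b * meanDist W P' := by
  simp only [meanDist, Pi.add_apply, Pi.smul_apply, smul_eq_mul, Finset.mul_sum,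
    ← Finset.sum_add_distrib]
  exact Finset.sum_congr rfl fun p _ => by ring

lemma expDB_eq_coe {W : X → Y → ℝ} {P : X × X → ℝ} (hP : P ∈ finiteDistSet W) :
    expDB W P = ((meanDist W P : ℝ) : EReal) := by
  have : ∀ p : X × X, (P p : EReal) * dB W p.1 p.2
      = ((P p * -Real.log (bhatt W p.1 p.2) : ℝ) : EReal) := by
    intro p
    by_cases h : bhatt W p.1 p.2 = 0
    · simp [hP.2 p h]
    · have h' : ¬ ∑ y, Real.sqrt (W p.1 y * W p.2 y) = 0 := h
      rw [dB, if_neg h', EReal.coe_mul]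
      rfl
  rw [expDB, meanDist, Finset.sum_congr rfl fun p _ => this p]
  exact (map_sum (⟨⟨Real.toEReal, rfl⟩, fun _ _ => rfl⟩ : ℝ →+ EReal) _ _).symm

/-- `A` is a strict lower bound of `𝔼[d_B] + ρ I` over couplings with first marginal `Q`. -/
def IsExpBound (W : X → Y → ℝ) (Q : X → ℝ) (ρ A : ℝ) : Prop :=
  ∀ P ∈ finiteDistSet W, (∀ x, ∑ x', P (x, x') = Q x) → A < meanDist W P + ρ * mutualInfo P

/-- Lagrange duality for the weak expurgated exponent. -/
lemma exists_isExpBound_of_lt_Eex' {W : X → Y → ℝ} {Q : X → ℝ} {R N : ℝ}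
    (h : (N : EReal) < Eex' W Q R) : ∃ ρ : ℝ, 1 ≤ ρ ∧ IsExpBound W Q ρ (N + ρ * R) := by
  obtain ⟨N', hN, hN'⟩ := EReal.lt_iff_exists_real_btwn.1 h
  set K : Set (X × X → ℝ) := finiteDistSet W ∩ fstMarginalSet Q with hK
  rcases K.eq_empty_or_nonempty with hemp | hne
  · refine ⟨1, le_rfl, fun P hP hPQ => ?_⟩
    have : P ∈ K := ⟨hP, hP.1, hPQ⟩
    simp [hemp] at this
  have hKconv : Convex ℝ K := (convex_finiteDistSet W).inter (convex_fstMarginalSet Q)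
  have hKcomp : IsCompact K := by
    have : K = finiteDistSet W ∩ {P | ∀ x, ∑ x', P (x, x') = Q x} := by
      ext P
      exact ⟨fun h => ⟨h.1, h.2.2⟩, fun h => ⟨h.1, h.1.1, h.2⟩⟩
    rw [this]
    refine (isCompact_finiteDistSet W).inter_right ?_
    simp only [Set.ofPred_forall]
    exact isClosed_iInter fun x => isClosed_eq
      (continuous_finsetSum _ fun x' _ => continuous_apply _) continuous_const
  let g : (X × X → ℝ) → ℝ → ℝ := fun P ρ => meanDist W P + ρ * (mutualInfo P - R)
  have hIc : ContinuousOn (mutualInfo : (X × X → ℝ) → ℝ) K :=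
    continuousOn_mutualInfo.mono fun P hP => hP.1.1
  have hgP : ∀ ρ ∈ Set.Ici (1 : ℝ), ContinuousOn (fun P => g P ρ) K := fun ρ _ =>
    (continuous_meanDist W).continuousOn.add
      (continuousOn_const.mul (hIc.sub continuousOn_const))
  have hgconv : ∀ ρ ∈ Set.Ici (1 : ℝ), ConvexOn ℝ K (fun P => g P ρ) := by
    intro ρ hρ
    refine ⟨hKconv, fun P hP P' hP' a b ha hb hab => ?_⟩
    have hI := (convexOn_mutualInfo Q).2 hP.2 hP'.2 ha hb hab
    simp only [g, meanDist_combo, smul_eq_mul] at hI ⊢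
    have hρ0 : (0 : ℝ) ≤ ρ := le_trans zero_le_one hρ
    have := mul_le_mul_of_nonneg_left hI hρ0
    have hR : R = a * R + b * R := by rw [← add_mul, hab, one_mul]
    have hρR : ρ * R = ρ * (a * R + b * R) := by rw [← hR]
    linarith
  have hmm := Sion.minimax' (X := K) (Y := Set.Ici (1 : ℝ))
    (f := fun P ρ => ((g P ρ : ℝ) : EReal)) hne hKconv hKcomp
    (fun ρ hρ => (continuous_coe_real_ereal.comp_continuousOn (hgP ρ hρ)).lowerSemicontinuousOn)
    (fun ρ hρ => QuasiconvexOn.monotone_comp (g := Real.toEReal) EReal.coe_strictMono.monotone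
      (hgconv ρ hρ).quasiconvexOn)
    (convex_Ici _)
    (fun P _ => by
      refine (continuous_coe_real_ereal.comp ?_).upperSemicontinuous.upperSemicontinuousOn _
      fun_prop)
    (fun P _ => by
      refine QuasiconcaveOn.monotone_comp (g := Real.toEReal) EReal.coe_strictMono.monotone
        (ConcaveOn.quasiconcaveOn (f := g P) ⟨convex_Ici _, ?_⟩)
      intro x _ y _ a b ha hb hab
      simp only [g, smul_eq_mul]
      have : meanDist W P = a * meanDist W P + b * meanDist W P := by
        rw [← add_mul, hab, one_mul]
      linarith)
  have hlow : (N' : EReal) ≤ ⨅ P ∈ K, ⨆ ρ ∈ Set.Ici (1 : ℝ), ((g P ρ : ℝ) : EReal) := by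
    refine le_iInf₂ fun P hP => ?_
    suffices hs : ∃ ρ : ℝ, 1 ≤ ρ ∧ N' ≤ g P ρ by
      obtain ⟨ρ, h1, h2⟩ := hs
      exact (EReal.coe_le_coe_iff.2 h2).trans
        (le_iSup₂ (f := fun ρ (_ : ρ ∈ Set.Ici (1 : ℝ)) => ((g P ρ : ℝ) : EReal)) ρ h1)
    rcases le_or_gt (mutualInfo P) R with hI | hI
    · refine ⟨1, le_rfl, ?_⟩
      have hE : Eex' W Q R ≤ expDB W P + ((mutualInfo P - R : ℝ) : EReal) :=
        sInf_le ⟨P, hP.1.1, hP.2.2, hI, rfl⟩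
      rw [expDB_eq_coe hP.1, ← EReal.coe_add] at hE
      have := EReal.coe_lt_coe_iff.1 (hN'.trans_le hE)
      simp only [g]
      linarith
    · refine ⟨max 1 ((N' - meanDist W P) / (mutualInfo P - R)), le_max_left _ _, ?_⟩
      have hpos : 0 < mutualInfo P - R := by linarith
      have := (div_le_iff₀ hpos).1 (le_max_right 1 ((N' - meanDist W P) / (mutualInfo P - R)))
      simp only [g]
      linarith
  have hlt := (hN.trans_le hlow).trans_eq hmm
  obtain ⟨ρ, hρ⟩ := lt_iSup_iff.1 hlt
  obtain ⟨hρ1, hρ⟩ := lt_iSup_iff.1 hρ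
  refine ⟨ρ, hρ1, fun P hP hPQ => ?_⟩
  have := EReal.coe_lt_coe_iff.1 (hρ.trans_le (iInf₂_le P ⟨hP, hP.1, hPQ⟩))
  simp only [g] at this
  linarith

/-- The bounds `IsExpBound` are stable under small changes of the first marginal. -/
lemma IsExpBound.exists_nhds {W : X → Y → ℝ} {Q : X → ℝ} {ρ A : ℝ} (h : IsExpBound W Q ρ A) :
    ∃ δ > 0, ∀ Q' : X → ℝ, (∀ x, |Q' x - Q x| ≤ δ) → IsExpBound W Q' ρ A := by
  let B : Set (X × X → ℝ) := finiteDistSet W ∩ {P | meanDist W P + ρ * mutualInfo P ≤ A}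
  have hBc : IsCompact B := by
    have hcont : ContinuousOn (fun P => meanDist W P + ρ * mutualInfo P) (finiteDistSet W) :=
      (continuous_meanDist W).continuousOn.add
        (continuousOn_const.mul (continuousOn_mutualInfo.mono fun P hP => hP.1))
    exact (isCompact_finiteDistSet W).of_isClosed_subset
      (hcont.preimage_isClosed_of_isClosed (isCompact_finiteDistSet W).isClosed isClosed_Iic)
      Set.inter_subset_left
  have hcl : IsClosed ((fun (P : X × X → ℝ) x => ∑ x', P (x, x')) '' B) :=
    (hBc.image (continuous_pi fun x => continuous_finsetSum _ fun x' _ =>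
      continuous_apply _)).isClosed
  have hmem : Q ∈ ((fun (P : X × X → ℝ) x => ∑ x', P (x, x')) '' B)ᶜ := by
    rintro ⟨P, hP, hPQ⟩
    exact absurd (h P hP.1 fun x => congrFun hPQ x) (not_lt.2 hP.2)
  obtain ⟨δ, hδ, hball⟩ := Metric.isOpen_iff.1 hcl.isOpen_compl Q hmem
  refine ⟨δ / 2, by positivity, fun Q' hQ' P hP hPQ => ?_⟩
  by_contra hcon
  refine hball (a := Q') ?_ ⟨P, ⟨hP, not_lt.1 hcon⟩, funext hPQ⟩
  refine lt_of_le_of_lt ((dist_pi_le_iff (by positivity)).2 fun x => ?_) (half_lt_self hδ)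
  rw [Real.dist_eq]
  exact hQ' x

end Bhattacharyya

section Tilting

variable {X Y : Type*} [Fintype X] [Fintype Y]

lemma sum_comp_eq_empDist {α : Type*} [Fintype α] {n : ℕ} (x : Fin n → α) (g : α → ℝ) :
    ∑ l, g (x l) = n * ∑ a, empDist x a * g a := by
  rcases Nat.eq_zero_or_pos n with rfl | hn
  · simp
  have hn' : (n : ℝ) ≠ 0 := by positivity
  rw [← Finset.sum_fiberwise (s := Finset.univ) (g := x), Finset.mul_sum]
  refine Finset.sum_congr rfl fun a _ => ?_
  rw [Finset.sum_congr rfl (g := fun _ => g a) fun l hl => by rw [(Finset.mem_filter.1 hl).2]]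
  rw [Finset.sum_const, nsmul_eq_mul, empDist]
  field_simp

/-- Exponential bound on the mean of `Z^(1/ρ)` when one codeword is drawn from a product
distribution and the other has type `Q`. -/
lemma IsExpBound.prod_sum_le {W : X → Y → ℝ} {Q Q' : X → ℝ} {ρ A : ℝ} (hQ : Q ∈ stdSimplex ℝ X)
    (hQ' : Q' ∈ stdSimplex ℝ X) (hρ : 0 < ρ) (h : IsExpBound W Q ρ A) {n : ℕ} (x : Fin n → X)
    (hx : empDist x = Q) :
    ∏ l, ∑ b, Q' b * bhatt W (x l) b ^ (1 / ρ) ≤ Real.exp (-(n * A / ρ)) := by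
  set S : X → ℝ := fun a => ∑ b, Q' b * bhatt W a b ^ (1 / ρ) with hS
  have hK : ∀ a b, 0 ≤ bhatt W a b ^ (1 / ρ) := fun a b =>
    Real.rpow_nonneg (bhatt_nonneg W a b) _
  have hS0 : ∀ a, 0 ≤ S a := fun a => Finset.sum_nonneg fun b _ => mul_nonneg (hQ'.1 b) (hK a b)
  by_cases hz : ∃ l, S (x l) = 0
  · obtain ⟨l, hl⟩ := hz
    rw [Finset.prod_eq_zero (Finset.mem_univ l) hl]
    positivity
  push Not at hz
  have hSpos : ∀ a, Q a ≠ 0 → 0 < S a := by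
    intro a ha
    refine (hS0 a).lt_of_ne fun h0 => ?_
    apply ha
    rw [← hx, empDist]
    rw [Finset.filter_false_of_mem]
    · simp
    · rintro l - rfl
      exact hz l h0.symm
  let P : X × X → ℝ := fun p => Q p.1 * (Q' p.2 * bhatt W p.1 p.2 ^ (1 / ρ)) / S p.1
  have hP0 : ∀ p, 0 ≤ P p := fun p =>
    div_nonneg (mul_nonneg (hQ.1 _) (mul_nonneg (hQ'.1 _) (hK _ _))) (hS0 _)
  have hmar : ∀ a, ∑ b, P (a, b) = Q a := by
    intro a
    simp only [P]
    rw [← Finset.sum_div, ← Finset.mul_sum]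
    change Q a * S a / S a = Q a
    rcases eq_or_ne (Q a) 0 with h0 | h0
    · simp [h0]
    · rw [mul_div_cancel_right₀ _ (hSpos a h0).ne']
  have hPs : P ∈ stdSimplex ℝ (X × X) := by
    refine ⟨hP0, ?_⟩
    rw [Fintype.sum_prod_type]
    simp only [hmar]
    exact hQ.2
  have hPf : P ∈ finiteDistSet W := by
    refine ⟨hPs, fun p hp => ?_⟩
    simp only [P, hp]
    rw [Real.zero_rpow (by positivity)]
    simp
  have hI := mutualInfo_le_divergence hPs hmar hQ' (fun p hp => by simp [P, hp])
  have hterm : ∀ p : X × X, P p * -Real.log (bhatt W p.1 p.2) +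
      ρ * (P p * Real.log (P p / (Q p.1 * Q' p.2))) = -ρ * (P p * Real.log (S p.1)) := by
    intro p
    rcases eq_or_ne (P p) 0 with h0 | h0
    · simp [h0]
    have hQp : Q p.1 ≠ 0 := fun h => h0 (by simp [P, h])
    have hQp' : Q' p.2 ≠ 0 := fun h => h0 (by simp [P, h])
    have hb : bhatt W p.1 p.2 ≠ 0 := fun h => h0 (hPf.2 p h)
    have hbp : 0 < bhatt W p.1 p.2 := (bhatt_nonneg W _ _).lt_of_ne hb.symm
    have hSp := hSpos _ hQp
    have : P p / (Q p.1 * Q' p.2) = bhatt W p.1 p.2 ^ (1 / ρ) / S p.1 := by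
      simp only [P]; field_simp
    rw [this, Real.log_div (Real.rpow_pos_of_pos hbp _).ne' hSp.ne', Real.log_rpow hbp]
    field_simp
    ring
  have hsum : meanDist W P + ρ * ∑ p : X × X, P p * Real.log (P p / (Q p.1 * Q' p.2))
      = -ρ * ∑ a, Q a * Real.log (S a) := by
    rw [meanDist, Finset.mul_sum, ← Finset.sum_add_distrib, Finset.sum_congr rfl fun p _ => hterm p,
      ← Finset.mul_sum, Fintype.sum_prod_type]
    congr 1
    refine Finset.sum_congr rfl fun a _ => ?_
    simp only [← Finset.sum_mul, hmar]
  have hA : A < -ρ * ∑ a, Q a * Real.log (S a) := by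
    rw [← hsum]
    exact (h P hPf hmar).trans_le (by gcongr)
  have hA' : ∑ a, Q a * Real.log (S a) ≤ -(A / ρ) := by
    rw [← neg_div, le_div_iff₀ hρ]
    linarith
  calc ∏ l, S (x l) = Real.exp (∑ l, Real.log (S (x l))) := by
        rw [Real.exp_sum]
        exact Finset.prod_congr rfl fun l _ =>
          (Real.exp_log ((hS0 _).lt_of_ne (hz l).symm)).symm
    _ ≤ Real.exp (-(n * A / ρ)) := by
        rw [Real.exp_le_exp, sum_comp_eq_empDist x (fun a => Real.log (S a)), hx]
        have := mul_le_mul_of_nonneg_left hA' (Nat.cast_nonneg (α := ℝ) n)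
        calc _ ≤ _ := this
          _ = _ := by ring

end Tilting

section TwoClasses

variable {V X Y : Type*} [Fintype V] [Fintype X] [Fintype Y]

/-- Distributions absolutely continuous with respect to `PV`. -/
def acSet (PV : V → ℝ) : Set (V → ℝ) :=
  {S | S ∈ stdSimplex ℝ V ∧ ∀ a, PV a = 0 → S a = 0}

lemma isCompact_acSet (PV : V → ℝ) : IsCompact (acSet PV) := by
  refine (isCompact_stdSimplex ℝ V).inter_right (t := {S | ∀ a, PV a = 0 → S a = 0}) ?_
  simp only [Set.ofPred_forall]
  exact isClosed_iInter fun p => isClosed_iInter fun _ =>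
    isClosed_eq (continuous_apply p) continuous_const

lemma convex_acSet (PV : V → ℝ) : Convex ℝ (acSet PV) := by
  intro P hP P' hP' a b ha hb hab
  refine ⟨convex_stdSimplex ℝ _ hP.1 hP'.1 ha hb hab, fun p hp => ?_⟩
  simp [hP.2 p hp, hP'.2 p hp]

/-- Divergence from `PV`, as a real number, for distributions in `acSet PV`. -/
def srcDiv (PV S : V → ℝ) : ℝ := -entH S - ∑ a, S a * Real.log (PV a)

lemma continuous_srcDiv (PV : V → ℝ) : Continuous (srcDiv PV) :=
  continuous_entH.neg.sub
    (continuous_finsetSum _ fun a _ => (continuous_apply a).mul continuous_const)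

lemma convexOn_srcDiv (PV : V → ℝ) : ConvexOn ℝ (acSet PV) (srcDiv PV) := by
  refine ⟨convex_acSet PV, fun P hP P' hP' a b ha hb hab => ?_⟩
  have h := concaveOn_entH.2 hP.1 hP'.1 ha hb hab
  have hl : ∑ x, (a • P + b • P') x * Real.log (PV x)
      = a * ∑ x, P x * Real.log (PV x) + b * ∑ x, P' x * Real.log (PV x) := by
    simp only [Pi.add_apply, Pi.smul_apply, smul_eq_mul, Finset.mul_sum, ← Finset.sum_add_distrib]
    exact Finset.sum_congr rfl fun p _ => by ring
  simp only [srcDiv, hl, smul_eq_mul] at h ⊢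
  linarith

lemma KL_eq_srcDiv {PV S : V → ℝ} (hS : S ∈ acSet PV) : KL S PV = ((srcDiv PV S : ℝ) : EReal) := by
  rw [KL, if_pos hS.2, srcDiv, entH, neg_neg, ← Finset.sum_sub_distrib]
  congr 1
  refine Finset.sum_congr rfl fun a _ => ?_
  rcases eq_or_ne (S a) 0 with h | h
  · simp [h]
  · rw [Real.log_div h fun h0 => h (hS.2 a h0)]; ring

/-- Rates at which the line `R ↦ A - ρ R`, added to the source exponent, is at most `M`. -/
def badRates (PV : V → ℝ) (t M ρ A : ℝ) : Set ℝ :=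
  {R | 0 ≤ R ∧ ∃ S ∈ acSet PV, R ≤ t * entH S ∧ t * srcDiv PV S + A - ρ * R ≤ M}

lemma badRates_eq_image (PV : V → ℝ) (t M ρ A : ℝ) :
    badRates PV t M ρ A = Prod.snd '' {z : (V → ℝ) × ℝ | z.1 ∈ acSet PV ∧ 0 ≤ z.2 ∧
      z.2 ≤ t * entH z.1 ∧ t * srcDiv PV z.1 + A - ρ * z.2 ≤ M} := by
  ext R
  constructor
  · rintro ⟨h0, S, hS, h1, h2⟩
    exact ⟨(S, R), ⟨hS, h0, h1, h2⟩, rfl⟩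
  · rintro ⟨⟨S, R'⟩, ⟨hS, h0, h1, h2⟩, rfl⟩
    exact ⟨h0, S, hS, h1, h2⟩

lemma isCompact_badRates (PV : V → ℝ) {t : ℝ} (ht : 0 < t) (M ρ A : ℝ) :
    IsCompact (badRates PV t M ρ A) := by
  rw [badRates_eq_image]
  refine IsCompact.image ?_ continuous_snd
  obtain ⟨C, hC⟩ := (isCompact_acSet PV).exists_bound_of_continuousOn
    (continuous_entH (α := V)).continuousOn
  have hc : IsCompact (acSet PV ×ˢ Set.Icc (0 : ℝ) (t * C)) :=
    (isCompact_acSet PV).prod isCompact_Icc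
  refine hc.of_isClosed_subset ?_ ?_
  · refine IsClosed.inter ((isCompact_acSet PV).isClosed.preimage continuous_fst) ?_
    refine IsClosed.inter (isClosed_le continuous_const continuous_snd) ?_
    refine IsClosed.inter (isClosed_le continuous_snd
      (continuous_const.mul (continuous_entH.comp continuous_fst))) ?_
    exact isClosed_le (((continuous_const.mul ((continuous_srcDiv PV).comp continuous_fst)).add
      continuous_const).sub (continuous_const.mul continuous_snd)) continuous_const
  · rintro ⟨S, R⟩ ⟨hS, h0, h1, _⟩
    refine ⟨hS, h0, h1.trans ?_⟩
    exact mul_le_mul_of_nonneg_left ((le_abs_self _).trans (hC S hS)) ht.le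

lemma convex_badRates (PV : V → ℝ) {t : ℝ} (ht : 0 < t) (M ρ A : ℝ) :
    Convex ℝ (badRates PV t M ρ A) := by
  rintro R ⟨h0, S, hS, h1, h2⟩ R' ⟨h0', S', hS', h1', h2'⟩ a b ha hb hab
  simp only [smul_eq_mul]
  refine ⟨by positivity, a • S + b • S', convex_acSet PV hS hS' ha hb hab, ?_, ?_⟩
  · have h := mul_le_mul_of_nonneg_left (concaveOn_entH.2 hS.1 hS'.1 ha hb hab) ht.le
    simp only [smul_eq_mul] at h
    nlinarith [mul_le_mul_of_nonneg_left h1 ha, mul_le_mul_of_nonneg_left h1' hb]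
  · have h := mul_le_mul_of_nonneg_left ((convexOn_srcDiv PV).2 hS hS' ha hb hab) ht.le
    simp only [smul_eq_mul] at h
    have e1 : M = a * M + b * M := by rw [← add_mul, hab, one_mul]
    have e2 : A = a * A + b * A := by rw [← add_mul, hab, one_mul]
    have := mul_le_mul_of_nonneg_left h2 ha
    have := mul_le_mul_of_nonneg_left h2' hb
    linarith

/-- The input distributions `Q 0` and `Q 1` suffice for the exponent `M`: source types of rate at
most some threshold satisfy the exponent bound with `Q 0`, the others with `Q 1`. -/
structure IsGoodPair (PV : V → ℝ) (W : X → Y → ℝ) (t M : ℝ) (Q : Fin 2 → X → ℝ)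
    (ρ A : Fin 2 → ℝ) (R : ℝ) : Prop where
  mem : ∀ c, Q c ∈ stdSimplex ℝ X
  one_le : ∀ c, 1 ≤ ρ c
  bound : ∀ c, IsExpBound W (Q c) (ρ c) (A c)
  nonneg : 0 ≤ R
  exists_lt : Nontrivial V → ∃ S ∈ stdSimplex ℝ V, R < t * entH S
  low : ∀ S ∈ acSet PV, t * entH S ≤ R → M < t * srcDiv PV S + A 0 - ρ 0 * (t * entH S)
  high : ∀ S ∈ acSet PV, R < t * entH S → M < t * srcDiv PV S + A 1 - ρ 1 * (t * entH S)

lemma exists_entH_pos [Nontrivial V] : ∃ S ∈ stdSimplex ℝ V, 0 < entH S := by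
  have hc : (1 : ℝ) < Fintype.card V := by exact_mod_cast Fintype.one_lt_card
  refine ⟨fun _ => (Fintype.card V : ℝ)⁻¹, ⟨fun _ => by positivity, ?_⟩, ?_⟩
  · rw [Finset.sum_const, nsmul_eq_mul, Finset.card_univ, mul_inv_cancel₀ (by positivity)]
  · rw [entH_eq_sum_negMulLog]
    refine Finset.sum_pos (fun a _ => ?_) Finset.univ_nonempty
    rw [Real.negMulLog, Real.log_inv]
    have := Real.log_pos hc
    have : (0 : ℝ) < (Fintype.card V : ℝ)⁻¹ := by positivity
    nlinarith

lemma exists_isExpBound (W : X → Y → ℝ) (Q : X → ℝ) (ρ : ℝ) : ∃ A, IsExpBound W Q ρ A := by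
  have hcont : ContinuousOn (fun P => meanDist W P + ρ * mutualInfo P) (finiteDistSet W) :=
    (continuous_meanDist W).continuousOn.add
      (continuousOn_const.mul (continuousOn_mutualInfo.mono fun P hP => hP.1))
  obtain ⟨C, hC⟩ := (isCompact_finiteDistSet W).exists_bound_of_continuousOn hcont
  refine ⟨-C - 1, fun P hP _ => ?_⟩
  have := neg_le_of_abs_le (hC P hP)
  linarith

lemma EJ2ex_le_of_forall_mem_badRates [Nonempty X] {PV : V → ℝ} {W : X → Y → ℝ} {t M R : ℝ}
    (ht : 0 < t) (hR : ∀ Q ∈ stdSimplex ℝ X, ∀ ρ A : ℝ, 1 ≤ ρ → IsExpBound W Q ρ A →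
      R ∈ badRates PV t M ρ A) : EJ2ex PV W t ≤ M := by
  obtain ⟨Q₀, hQ₀⟩ : (stdSimplex ℝ X).Nonempty :=
    ⟨_, single_mem_stdSimplex ℝ (Classical.arbitrary X)⟩
  have hsrc : ∀ Q ∈ stdSimplex ℝ X, ∀ ρ A : ℝ, 1 ≤ ρ → IsExpBound W Q ρ A →
      (t : EReal) * srcRel PV (R / t) ≤ ((M - A + ρ * R : ℝ) : EReal) := by
    intro Q hQ ρ A hρ hA
    obtain ⟨_, S, hS, h1, h2⟩ := hR Q hQ ρ A hρ hA
    have : srcRel PV (R / t) ≤ ((srcDiv PV S : ℝ) : EReal) :=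
      sInf_le ⟨S, hS.1, by rwa [div_le_iff₀ ht, mul_comm], (KL_eq_srcDiv hS).symm⟩
    calc (t : EReal) * srcRel PV (R / t) ≤ (t : EReal) * ((srcDiv PV S : ℝ) : EReal) :=
          mul_le_mul_of_nonneg_left this (by exact_mod_cast ht.le)
      _ = ((t * srcDiv PV S : ℝ) : EReal) := (EReal.coe_mul _ _).symm
      _ ≤ _ := EReal.coe_le_coe_iff.2 (by linarith)
  obtain ⟨A₀, hA₀⟩ := exists_isExpBound W Q₀ 1
  have hR0 : 0 ≤ R := (hR Q₀ hQ₀ 1 A₀ le_rfl hA₀).1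
  have hle : EJ2ex PV W t ≤ (t : EReal) * srcRel PV (R / t) +
      sSup { w | ∃ Q ∈ stdSimplex ℝ X, w = Eex' W Q R } := sInf_le ⟨R, hR0, rfl⟩
  refine hle.trans ?_
  have h0 := hsrc Q₀ hQ₀ 1 A₀ le_rfl hA₀
  generalize (t : EReal) * srcRel PV (R / t) = s at hsrc h0
  induction s with
  | bot => simp
  | top => exact absurd h0 (not_le.2 (EReal.coe_lt_top _))
  | coe r =>
    have hG : sSup { w | ∃ Q ∈ stdSimplex ℝ X, w = Eex' W Q R } ≤ ((M - r : ℝ) : EReal) := by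
      refine sSup_le ?_
      rintro _ ⟨Q, hQ, rfl⟩
      by_contra hcon
      obtain ⟨N, hN1, hN2⟩ := EReal.lt_iff_exists_real_btwn.1 (not_le.1 hcon)
      obtain ⟨ρ, hρ, hb⟩ := exists_isExpBound_of_lt_Eex' hN2
      have h1 := EReal.coe_le_coe_iff.1 (hsrc Q hQ ρ _ hρ hb)
      have h2 := EReal.coe_lt_coe_iff.1 hN1
      linarith
    calc _ ≤ (r : EReal) + ((M - r : ℝ) : EReal) := by gcongr
      _ = M := by rw [← EReal.coe_add]; congr 1; ring

/-- Two input distributions suffice below the exponent `EJ2ex`, by Helly's theorem on the line. -/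
lemma exists_isGoodPair [Nonempty X] {PV : V → ℝ} {W : X → Y → ℝ} {t M : ℝ} (ht : 0 < t)
    (hM : (M : EReal) < EJ2ex PV W t) : ∃ Q ρ A R, IsGoodPair PV W t M Q ρ A R := by
  let ι := {z : (X → ℝ) × ℝ × ℝ // z.1 ∈ stdSimplex ℝ X ∧ 1 ≤ z.2.1 ∧ IsExpBound W z.1 z.2.1 z.2.2}
  let C : ι → Set ℝ := fun z => badRates PV t M z.1.2.1 z.1.2.2
  have hnot : ∀ (z : ι) (S : V → ℝ), S ∈ acSet PV → t * entH S ∉ C z →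
      M < t * srcDiv PV S + z.1.2.2 - z.1.2.1 * (t * entH S) := by
    intro z S hS h
    by_contra hcon
    exact h ⟨mul_nonneg ht.le (entH_nonneg hS.1), S, hS, le_rfl, not_lt.1 hcon⟩
  have hsingle : ∀ z : ι, C z = ∅ → ∃ Q ρ A R, IsGoodPair PV W t M Q ρ A R := by
    intro z hz
    refine ⟨fun _ => z.1.1, fun _ => z.1.2.1, fun _ => z.1.2.2, 0, fun _ => z.2.1, fun _ => z.2.2.1,
      fun _ => z.2.2.2, le_rfl, ?_, fun S hS _ => hnot z S hS (by simp [hz]),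
      fun S hS _ => hnot z S hS (by simp [hz])⟩
    intro hV
    obtain ⟨S, hS, hpos⟩ := exists_entH_pos (V := V)
    exact ⟨S, hS, mul_pos ht hpos⟩
  have hpair : ∀ (z z' : ι) (a b : ℝ), IsGreatest (C z) a → IsGreatest (C z') b → a < b →
      C z ∩ C z' = ∅ → ∃ Q ρ A R, IsGoodPair PV W t M Q ρ A R := by
    intro z z' a b ha hb hab hdis
    have hgt : ∀ R ∈ C z', a < R := by
      intro R hR
      by_contra hcon
      have : a ∈ C z' := (convex_badRates PV ht _ _ _).ordConnected.out hR hb.1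
        ⟨not_lt.1 hcon, hab.le⟩
      exact (Set.eq_empty_iff_forall_notMem.1 hdis) a ⟨ha.1, this⟩
    refine ⟨![z'.1.1, z.1.1], ![z'.1.2.1, z.1.2.1], ![z'.1.2.2, z.1.2.2], a, ?_, ?_, ?_, ha.1.1, ?_,
      fun S hS h => hnot z' S hS fun hmem => absurd (hgt _ hmem) (not_lt.2 h),
      fun S hS h => hnot z S hS fun hmem => absurd (ha.2 hmem) (not_le.2 h)⟩
    · rw [Fin.forall_fin_two]; exact ⟨z'.2.1, z.2.1⟩
    · rw [Fin.forall_fin_two]; exact ⟨z'.2.2.1, z.2.2.1⟩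
    · rw [Fin.forall_fin_two]; exact ⟨z'.2.2.2, z.2.2.2⟩
    · intro _
      obtain ⟨_, S, hS, h1, _⟩ := hb.1
      exact ⟨S, hS.1, hab.trans_le h1⟩
  have hdisj : ∃ z z' : ι, C z ∩ C z' = ∅ := by
    by_contra hcon
    push Not at hcon
    have hne : (⋂ z, C z).Nonempty := by
      refine Convex.helly_theorem_compact' (𝕜 := ℝ) (fun z => convex_badRates PV ht _ _ _)
        (fun z => isCompact_badRates PV ht _ _ _) fun I hI => ?_
      rw [Module.finrank_self] at hI
      rcases I.eq_empty_or_nonempty with rfl | ⟨z, hz⟩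
      · simp
      have h1 : (I.erase z).card ≤ 1 := by
        rw [Finset.card_erase_of_mem hz]; omega
      obtain ⟨z', hz'⟩ : ∃ z', I.erase z ⊆ {z'} := by
        rcases (I.erase z).eq_empty_or_nonempty with h | ⟨w, hw⟩
        · exact ⟨z, by simp [h]⟩
        · exact ⟨w, fun u hu => by
            rw [Finset.mem_singleton]; exact Finset.card_le_one.1 h1 u hu w hw⟩
      refine (hcon z z').mono fun R hR => ?_
      simp only [Set.mem_iInter]
      intro i hi
      by_cases h : i = z
      · rw [h]; exact hR.1
      · have := Finset.mem_singleton.1 (hz' (Finset.mem_erase.2 ⟨h, hi⟩))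
        rw [this]; exact hR.2
    obtain ⟨R, hR⟩ := hne
    rw [Set.mem_iInter] at hR
    exact absurd hM (not_lt.2 (EJ2ex_le_of_forall_mem_badRates ht fun Q hQ ρ A hρ hA =>
      hR ⟨(Q, ρ, A), hQ, hρ, hA⟩))
  obtain ⟨z, z', hzz⟩ := hdisj
  rcases (C z).eq_empty_or_nonempty with h | h
  · exact hsingle z h
  rcases (C z').eq_empty_or_nonempty with h' | h'
  · exact hsingle z' h'
  obtain ⟨a, ha⟩ := (isCompact_badRates PV ht _ _ _).exists_isGreatest h
  obtain ⟨b, hb⟩ := (isCompact_badRates PV ht _ _ _).exists_isGreatest h'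
  rcases lt_trichotomy a b with hab | hab | hab
  · exact hpair z z' a b ha hb hab hzz
  · exact absurd ⟨ha.1, hab ▸ hb.1⟩ ((Set.eq_empty_iff_forall_notMem.1 hzz) a)
  · exact hpair z' z b a hb ha hab (by rwa [Set.inter_comm])

/-- The exponent is bounded below. -/
lemma exists_real_lt_EJ2ex [Nonempty X] (PV : V → ℝ) {W : X → Y → ℝ} (hW : IsDMC W) {t : ℝ}
    (ht : 0 < t) : ∃ M : ℝ, (M : EReal) < EJ2ex PV W t := by
  obtain ⟨Q₀, hQ₀⟩ : (stdSimplex ℝ X).Nonempty :=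
    ⟨_, single_mem_stdSimplex ℝ (Classical.arbitrary X)⟩
  obtain ⟨C, hC⟩ := (isCompact_stdSimplex ℝ (X × X)).exists_bound_of_continuousOn
    continuousOn_mutualInfo
  obtain ⟨C₁, hC₁⟩ := (isCompact_stdSimplex ℝ V).exists_bound_of_continuousOn
    (continuous_entH (α := V)).continuousOn
  obtain ⟨C₂, hC₂⟩ := (isCompact_acSet PV).exists_bound_of_continuousOn
    (continuous_srcDiv PV).continuousOn
  have hdB : ∀ x x' : X, 0 ≤ dB W x x' := by
    intro x x'
    rw [dB]
    split_ifs with h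
    · exact le_top
    · rw [EReal.coe_nonneg, neg_nonneg]
      exact Real.log_nonpos (bhatt_nonneg W x x') (bhatt_le_one hW x x')
  have hE : ∀ R : ℝ, ((-C - R : ℝ) : EReal) ≤
      sSup { w | ∃ Q ∈ stdSimplex ℝ X, w = Eex' W Q R } := by
    intro R
    refine le_trans ?_ (le_sSup ⟨Q₀, hQ₀, rfl⟩)
    refine le_sInf ?_
    rintro _ ⟨P, hP, _, _, rfl⟩
    have h1 : (0 : EReal) ≤ expDB W P :=
      Finset.sum_nonneg fun p _ => mul_nonneg (EReal.coe_nonneg.2 (hP.1 p)) (hdB _ _)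
    have h2 := neg_le_of_abs_le (hC P hP)
    calc ((-C - R : ℝ) : EReal) ≤ ((mutualInfo P - R : ℝ) : EReal) :=
          EReal.coe_le_coe_iff.2 (by linarith)
      _ ≤ _ := le_add_of_nonneg_left h1
  refine ⟨t * (-C₂) + (-C - t * C₁) - 1, lt_of_lt_of_le
    (b := ((t * (-C₂) + (-C - t * C₁) : ℝ) : EReal)) (EReal.coe_lt_coe_iff.2 (by linarith)) ?_⟩
  refine le_sInf ?_
  rintro _ ⟨R, hR, rfl⟩
  rcases le_or_gt R (t * C₁) with h | h
  · rw [EReal.coe_add, EReal.coe_mul]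
    refine add_le_add (mul_le_mul_of_nonneg_left ?_ (by exact_mod_cast ht.le))
      ((EReal.coe_le_coe_iff.2 (by linarith)).trans (hE R))
    refine le_sInf ?_
    rintro _ ⟨S, hS, _, rfl⟩
    by_cases hac : ∀ a, PV a = 0 → S a = 0
    · rw [KL_eq_srcDiv ⟨hS, hac⟩]
      exact EReal.coe_le_coe_iff.2 (neg_le_of_abs_le (hC₂ S ⟨hS, hac⟩))
    · rw [KL, if_neg hac]; exact le_top
  · have htop : srcRel PV (R / t) = ⊤ := by
      rw [srcRel, sInf_eq_top]
      rintro _ ⟨S, hS, hle, rfl⟩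
      rw [div_le_iff₀ ht] at hle
      have := mul_le_mul_of_nonneg_left ((le_abs_self _).trans (hC₁ S hS)) ht.le
      linarith
    rw [htop, EReal.coe_mul_top_of_pos ht, EReal.top_add_of_ne_bot]
    · exact le_top
    · exact ((EReal.bot_lt_coe _).trans_le (hE R)).ne'

end TwoClasses

section PermutationAverage

lemma factorial_mul_exp_le (m : ℕ) :
    (m.factorial : ℝ) * Real.exp m ≤ Real.exp 1 * (m + 1) * (m : ℝ) ^ m := by
  have key : ∀ m : ℕ, ((m + 1).factorial : ℝ) * Real.exp (m + 1 : ℕ) ≤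
      Real.exp 1 * (m + 1 : ℕ) * ((m + 1 : ℕ) : ℝ) ^ (m + 1) := by
    intro m
    induction m with
    | zero => simp
    | succ m ih =>
      have hlog : Real.exp 1 * ((m + 1 : ℕ) : ℝ) ^ (m + 2) ≤ ((m + 2 : ℕ) : ℝ) ^ (m + 2) := by
        have hm : (0 : ℝ) < (m + 1 : ℕ) := by positivity
        have hm2 : (0 : ℝ) < (m + 2 : ℕ) := by positivity
        have h := Real.log_le_sub_one_of_pos (div_pos hm hm2)
        have h1 : (m + 2 : ℕ) * Real.log ((m + 1 : ℕ) / (m + 2 : ℕ) : ℝ) ≤ -1 := by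
          have := mul_le_mul_of_nonneg_left h hm2.le
          refine this.trans (le_of_eq ?_)
          field_simp
          push_cast
          ring
        have h2 : ((m + 1 : ℕ) / (m + 2 : ℕ) : ℝ) ^ (m + 2) ≤ Real.exp (-1) := by
          rw [← Real.exp_log (pow_pos (div_pos hm hm2) (m + 2)), Real.exp_le_exp, Real.log_pow]
          exact h1
        rw [div_pow, div_le_iff₀ (by positivity)] at h2
        calc _ ≤ Real.exp 1 * (Real.exp (-1) * ((m + 2 : ℕ) : ℝ) ^ (m + 2)) := by gcongr
          _ = _ := by rw [← mul_assoc, ← Real.exp_add]; simp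
      have e1 : Real.exp ((m + 1 + 1 : ℕ) : ℝ) = Real.exp 1 * Real.exp ((m + 1 : ℕ) : ℝ) := by
        rw [← Real.exp_add]; congr 1; push_cast; ring
      rw [Nat.factorial_succ, e1]
      calc (((m + 1 + 1) * (m + 1).factorial : ℕ) : ℝ) * (Real.exp 1 * Real.exp ((m + 1 : ℕ) : ℝ))
          = (m + 2 : ℕ) * Real.exp 1 * ((m + 1).factorial * Real.exp ((m + 1 : ℕ) : ℝ)) := by
            push_cast; ring
        _ ≤ (m + 2 : ℕ) * Real.exp 1 * (Real.exp 1 * (m + 1 : ℕ) * ((m + 1 : ℕ) : ℝ) ^ (m + 1)) := by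
            gcongr
        _ = Real.exp 1 * (m + 2 : ℕ) * (Real.exp 1 * ((m + 1 : ℕ) : ℝ) ^ (m + 2)) := by ring
        _ ≤ Real.exp 1 * (m + 2 : ℕ) * ((m + 2 : ℕ) : ℝ) ^ (m + 2) := by gcongr
  cases m with
  | zero => simp
  | succ m =>
    refine (key m).trans ?_
    gcongr
    linarith

variable {X : Type*} [Fintype X] {n : ℕ}

/-- Number of occurrences of a letter. -/
def letterCount (x : Fin n → X) (a : X) : ℕ := (Finset.univ.filter fun i => x i = a).card

lemma sum_letterCount (x : Fin n → X) : ∑ a, letterCount x a = n := by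
  have := Finset.card_eq_sum_card_fiberwise (s := Finset.univ) (t := Finset.univ) (f := x)
    fun _ _ => Finset.mem_coe.2 (Finset.mem_univ _)
  rw [Finset.card_univ, Fintype.card_fin] at this
  exact this.symm

omit [Fintype X] in
lemma letterCount_le (x : Fin n → X) (a : X) : letterCount x a ≤ n := by
  simpa [letterCount] using Finset.card_filter_le (Finset.univ : Finset (Fin n)) fun i => x i = a

lemma prod_comp_eq_letterCount (x : Fin n → X) (g : X → ℝ) :
    ∏ l, g (x l) = ∏ a, g a ^ letterCount x a := by
  rw [← Finset.prod_fiberwise (s := Finset.univ) (g := x)]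
  refine Finset.prod_congr rfl fun a _ => ?_
  rw [Finset.prod_congr rfl (g := fun _ => g a) fun l hl => by rw [(Finset.mem_filter.1 hl).2],
    Finset.prod_const]
  rfl

lemma empDist_mem_stdSimplex (hn : 0 < n) (x : Fin n → X) : empDist x ∈ stdSimplex ℝ X := by
  refine ⟨fun a => by unfold empDist; positivity, ?_⟩
  have h : ∑ a, empDist x a = (∑ a, (letterCount x a : ℝ)) / n := by
    rw [Finset.sum_div]; rfl
  rw [h, ← Nat.cast_sum, sum_letterCount, div_self (by positivity)]

omit [Fintype X] in
lemma empDist_comp_perm (x : Fin n → X) (σ : Equiv.Perm (Fin n)) :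
    empDist (x ∘ σ) = empDist x := by
  funext a
  simp only [empDist]
  congr 2
  refine Finset.card_bij (fun i _ => σ i) (fun i hi => by simpa using hi)
    (fun i _ j _ h => σ.injective h) fun j hj => ⟨σ.symm j, by simpa using hj, by simp⟩

lemma prod_factorial_le (x : Fin n → X) :
    ∏ a, ((letterCount x a).factorial : ℝ) ≤ n.factorial *
      ((Real.exp 1 * (n + 1)) ^ Fintype.card X * ∏ a, empDist x a ^ letterCount x a) := by
  rcases Nat.eq_zero_or_pos n with rfl | hn
  · have h0 : ∀ a, letterCount x a = 0 := fun a => Nat.le_zero.1 (letterCount_le x a)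
    simp only [h0]
    simp only [Nat.factorial_zero, Nat.cast_one, Finset.prod_const_one, pow_zero, mul_one, one_mul,
      Nat.cast_zero, zero_add]
    exact one_le_pow₀ (Real.one_le_exp zero_le_one)
  have hn' : (0 : ℝ) < n := by positivity
  have h1 : ∀ a, ((letterCount x a).factorial : ℝ) ≤ (Real.exp 1 * (n + 1)) *
      ((letterCount x a : ℝ) ^ letterCount x a * Real.exp (-(letterCount x a : ℝ))) := by
    intro a
    have h := factorial_mul_exp_le (letterCount x a)
    have hle : (letterCount x a : ℝ) ≤ n := by exact_mod_cast letterCount_le x a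
    have h2 : ((letterCount x a).factorial : ℝ) =
        (letterCount x a).factorial * Real.exp (letterCount x a) *
          Real.exp (-(letterCount x a : ℝ)) := by
      rw [mul_assoc, ← Real.exp_add]; simp
    rw [h2]
    calc _ ≤ Real.exp 1 * (letterCount x a + 1) * (letterCount x a : ℝ) ^ letterCount x a *
          Real.exp (-(letterCount x a : ℝ)) := by gcongr
      _ ≤ Real.exp 1 * (n + 1) * (letterCount x a : ℝ) ^ letterCount x a *
          Real.exp (-(letterCount x a : ℝ)) := by gcongr
      _ = _ := by ring
  refine (Finset.prod_le_prod (fun a _ => by positivity) fun a _ => h1 a).trans ?_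
  rw [Finset.prod_mul_distrib, Finset.prod_const, Finset.card_univ, Finset.prod_mul_distrib,
    ← Real.exp_sum]
  have hs : ∑ a, -(letterCount x a : ℝ) = -n := by
    rw [Finset.sum_neg_distrib, ← Nat.cast_sum, sum_letterCount]
  have he : ∏ a, empDist x a ^ letterCount x a =
      (∏ a, (letterCount x a : ℝ) ^ letterCount x a) / (n : ℝ) ^ n := by
    have : ∀ a, empDist x a ^ letterCount x a =
        (letterCount x a : ℝ) ^ letterCount x a / (n : ℝ) ^ letterCount x a := fun a => div_pow _ _ _
    rw [Finset.prod_congr rfl fun a _ => this a, Finset.prod_div_distrib, Finset.prod_pow_eq_pow_sum,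
      sum_letterCount]
  rw [hs, he]
  have hfac := Real.pow_div_factorial_le_exp (n : ℝ) hn'.le n
  rw [div_le_iff₀ (by positivity)] at hfac
  have hfac' : Real.exp (-(n : ℝ)) ≤ n.factorial / (n : ℝ) ^ n := by
    rw [le_div_iff₀ (by positivity)]
    calc Real.exp (-(n : ℝ)) * (n : ℝ) ^ n ≤ Real.exp (-(n : ℝ)) * (Real.exp n * n.factorial) := by
          gcongr
      _ = n.factorial := by rw [← mul_assoc, ← Real.exp_add]; simp
  calc _ ≤ (Real.exp 1 * (n + 1)) ^ Fintype.card X *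
        ((∏ a, (letterCount x a : ℝ) ^ letterCount x a) * (n.factorial / (n : ℝ) ^ n)) := by gcongr
    _ = _ := by ring

/-- A uniformly permuted sequence is dominated, up to a polynomial factor, by the product
distribution of its type. -/
lemma sum_perm_le (x : Fin n → X) (F : (Fin n → X) → ℝ) (hF : ∀ x', 0 ≤ F x') :
    ∑ σ : Equiv.Perm (Fin n), F (x ∘ σ) ≤ n.factorial *
      ((Real.exp 1 * (n + 1)) ^ Fintype.card X * ∑ x', prodDist (empDist x) x' * F x') := by
  rw [← Finset.sum_fiberwise (s := Finset.univ) (g := fun σ : Equiv.Perm (Fin n) => x ∘ σ),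
    Finset.mul_sum, Finset.mul_sum]
  refine Finset.sum_le_sum fun x' _ => ?_
  rw [Finset.sum_congr rfl (g := fun _ => F x') fun l hl => by rw [(Finset.mem_filter.1 hl).2],
    Finset.sum_const, nsmul_eq_mul]
  have hpd : 0 ≤ prodDist (empDist x) x' :=
    Finset.prod_nonneg fun i _ => by unfold empDist; positivity
  rcases (Finset.univ.filter fun σ : Equiv.Perm (Fin n) => x ∘ σ = x').eq_empty_or_nonempty with
    h | ⟨σ₀, hσ₀⟩
  · rw [h]
    simp only [Finset.card_empty, Nat.cast_zero, zero_mul]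
    have := hF x'
    positivity
  have hσ₀ : x ∘ σ₀ = x' := (Finset.mem_filter.1 hσ₀).2
  have hcard : ((Finset.univ.filter fun σ : Equiv.Perm (Fin n) => x ∘ σ = x').card : ℝ)
      = ∏ a, ((letterCount x a).factorial : ℝ) := by
    have h1 := DomMulAct.stabilizer_card x
    have h2 : ∀ a, Fintype.card {i // x i = a} = letterCount x a := fun a =>
      Fintype.card_subtype _
    simp only [h2] at h1
    rw [Fintype.card_subtype] at h1
    rw [← Nat.cast_prod, ← h1]
    norm_cast
    refine Finset.card_bij (fun σ _ => σ * σ₀⁻¹) ?_ ?_ ?_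
    · intro σ hσ
      have hσ : x ∘ σ = x' := by simpa using hσ
      simp only [Finset.mem_filter, Finset.mem_univ, true_and]
      funext i
      have := congrFun (hσ.trans hσ₀.symm) (σ₀⁻¹ i)
      simpa using this
    · intro σ _ σ' _ h
      exact mul_right_cancel h
    · intro g hg
      have hg : x ∘ g = x := by simpa using hg
      refine ⟨g * σ₀, ?_, by simp⟩
      simp only [Finset.mem_filter, Finset.mem_univ, true_and]
      rw [← hσ₀]
      funext i
      exact congrFun hg (σ₀ i)
  have hprod : prodDist (empDist x) x' = ∏ a, empDist x a ^ letterCount x a := by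
    rw [← prod_comp_eq_letterCount x (empDist x), prodDist, ← hσ₀]
    exact Equiv.prod_comp σ₀ fun l => empDist x (x l)
  rw [hcard, hprod]
  calc _ ≤ n.factorial * ((Real.exp 1 * (n + 1)) ^ Fintype.card X *
        ∏ a, empDist x a ^ letterCount x a) * F x' :=
        mul_le_mul_of_nonneg_right (prod_factorial_le x) (hF x')
    _ = _ := by ring

/-- Mean of `Z^(1/ρ)` over a uniformly permuted codeword. -/
lemma IsExpBound.sum_perm_le {Y : Type*} [Fintype Y] {W : X → Y → ℝ} {ρ A : ℝ} (hn : 0 < n)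
    (hρ : 0 < ρ) {z : Fin n → X} (h : IsExpBound W (empDist z) ρ A) (x : Fin n → X) :
    ∑ σ : Equiv.Perm (Fin n), ∏ l, bhatt W (z l) (x (σ l)) ^ (1 / ρ) ≤ n.factorial *
      ((Real.exp 1 * (n + 1)) ^ Fintype.card X * Real.exp (-(n * A / ρ))) := by
  refine (_root_.sum_perm_le x (fun x' => ∏ l, bhatt W (z l) (x' l) ^ (1 / ρ)) fun x' =>
    Finset.prod_nonneg fun l _ => Real.rpow_nonneg (bhatt_nonneg W _ _) _).trans ?_
  gcongr
  refine le_trans (le_of_eq ?_) (h.prod_sum_le (empDist_mem_stdSimplex hn z)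
    (empDist_mem_stdSimplex hn x) hρ z rfl)
  rw [Finset.prod_univ_sum, Fintype.piFinset_univ]
  refine Finset.sum_congr rfl fun x' _ => ?_
  rw [prodDist, Finset.prod_mul_distrib]

end PermutationAverage

section Expurgation

lemma sum_pi_pair_le {J G : Type*} [Fintype J] [DecidableEq J] [Fintype G] {j j' : J} (hj : j ≠ j')
    (F : G → G → ℝ) (b : ℝ) (hF : ∀ g', ∑ g, F g g' ≤ Fintype.card G * b) :
    ∑ σ : J → G, F (σ j) (σ j') ≤ Fintype.card (J → G) * b := by
  have h1 : ∑ σ : J → G, F (σ j) (σ j') =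
      ∑ z : G × ({i // i ≠ j} → G), F z.1 (z.2 ⟨j', hj.symm⟩) :=
    Fintype.sum_equiv (Equiv.funSplitAt j G) _ _ fun σ => by simp [Equiv.funSplitAt]
  rw [h1, Fintype.sum_prod_type_right, Fintype.card_congr (Equiv.funSplitAt j G),
    Fintype.card_prod]
  refine (Finset.sum_le_sum fun τ _ => hF _).trans (le_of_eq ?_)
  rw [Finset.sum_const, Finset.card_univ, nsmul_eq_mul]
  push_cast
  ring

lemma sum_inv_card_fiber_le {J I : Type*} [Fintype J] [Fintype I] (τ : J → I) :
    ∑ j, ((Finset.univ.filter fun j' => τ j' = τ j).card : ℝ)⁻¹ ≤ Fintype.card I := by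
  rw [← Finset.sum_fiberwise (s := Finset.univ) (g := τ)]
  have : ∀ i : I, ∑ j ∈ Finset.univ.filter (fun j => τ j = i),
      ((Finset.univ.filter fun j' => τ j' = τ j).card : ℝ)⁻¹ ≤ 1 := by
    intro i
    rw [Finset.sum_congr rfl
      (g := fun _ => ((Finset.univ.filter fun j' => τ j' = i).card : ℝ)⁻¹)
      fun j hj => by rw [(Finset.mem_filter.1 hj).2], Finset.sum_const, nsmul_eq_mul]
    exact mul_inv_le_one
  refine (Finset.sum_le_sum fun i _ => this i).trans ?_
  simp

/-- Expurgation: if the mean of every pairwise cost is small, then there is a choice of labels for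
which all partial sums of costs over a fibre of `τ` are small. -/
lemma exists_expurgated {α I G : Type*} [Fintype α] [Fintype I] [Fintype G] [Nonempty G]
    (τ : α → I) (K : I → I → G → G → ℝ) (hK0 : ∀ i i' g g', 0 ≤ K i i' g g') (b : I → ℝ)
    (hb : ∀ i, 0 < b i) (hK : ∀ i i' g', ∑ g, K i i' g g' ≤ Fintype.card G * b i') :
    ∃ f : α → G, ∀ v i, ∑ v' ∈ Finset.univ.filter (fun v' => τ v' = i ∧ v' ≠ v),
      K (τ v) i (f v) (f v') ≤
        4 * (Fintype.card I : ℝ) ^ 2 * (Finset.univ.filter fun v' => τ v' = i).card * b i := by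
  let τ' : α × Bool → I := fun j => τ j.1
  let N' : I → ℝ := fun i => ((Finset.univ.filter fun j => τ' j = i).card : ℝ)
  have hN' : ∀ i, N' i = 2 * ((Finset.univ.filter fun v' => τ v' = i).card : ℝ) := by
    intro i
    have : (Finset.univ.filter fun j : α × Bool => τ' j = i) =
        (Finset.univ.filter fun v' => τ v' = i) ×ˢ Finset.univ := by
      ext ⟨v, β⟩; simp [τ']
    simp only [N', this, Finset.card_product, Finset.card_univ, Fintype.card_bool]
    push_cast; ring
  have hN'pos : ∀ j, 0 < N' (τ' j) := fun j => by
    have : 0 < (Finset.univ.filter fun j' => τ' j' = τ' j).card :=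
      Finset.card_pos.2 ⟨j, by simp⟩
    exact Nat.cast_pos.2 this
  let s : (α × Bool → G) → α × Bool → ℝ := fun σ j =>
    ∑ j' ∈ Finset.univ.filter (fun j' => j' ≠ j),
      K (τ' j) (τ' j') (σ j) (σ j') / (N' (τ' j') * b (τ' j'))
  have hs0 : ∀ σ j, 0 ≤ s σ j := fun σ j => Finset.sum_nonneg fun j' _ =>
    div_nonneg (hK0 _ _ _ _) (mul_nonneg (hN'pos j').le (hb _).le)
  have hmean : ∀ j, ∑ σ, s σ j ≤ Fintype.card (α × Bool → G) * Fintype.card I := by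
    intro j
    simp only [s]
    rw [Finset.sum_comm]
    calc _ ≤ ∑ j' ∈ Finset.univ.filter (fun j' => j' ≠ j),
          (Fintype.card (α × Bool → G) : ℝ) * (N' (τ' j'))⁻¹ := by
          refine Finset.sum_le_sum fun j' hj' => ?_
          rw [← Finset.sum_div, div_le_iff₀ (mul_pos (hN'pos j') (hb _))]
          refine (sum_pi_pair_le (Finset.mem_filter.1 hj').2.symm (K (τ' j) (τ' j')) _
            (hK _ _)).trans (le_of_eq ?_)
          have := (hN'pos j').ne'
          field_simp
      _ ≤ ∑ j', (Fintype.card (α × Bool → G) : ℝ) * (N' (τ' j'))⁻¹ :=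
          Finset.sum_le_sum_of_subset_of_nonneg (Finset.filter_subset _ _) fun j' _ _ => by
            have := hN'pos j'
            positivity
      _ ≤ _ := by
          rw [← Finset.mul_sum]
          exact mul_le_mul_of_nonneg_left (sum_inv_card_fiber_le τ') (by positivity)
  obtain ⟨σ, -, hσ⟩ : ∃ σ ∈ (Finset.univ : Finset (α × Bool → G)),
      ∑ j, s σ j * (N' (τ' j))⁻¹ ≤ (Fintype.card I : ℝ) ^ 2 := by
    refine Finset.exists_le_of_sum_le Finset.univ_nonempty ?_
    rw [Finset.sum_comm, Finset.sum_const, Finset.card_univ, nsmul_eq_mul]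
    calc _ ≤ ∑ j, (Fintype.card (α × Bool → G) * Fintype.card I : ℝ) * (N' (τ' j))⁻¹ := by
          refine Finset.sum_le_sum fun j _ => ?_
          rw [← Finset.sum_mul]
          exact mul_le_mul_of_nonneg_right (hmean j) (inv_nonneg.2 (hN'pos j).le)
      _ ≤ (Fintype.card (α × Bool → G) * Fintype.card I : ℝ) * Fintype.card I := by
          rw [← Finset.mul_sum]
          exact mul_le_mul_of_nonneg_left (sum_inv_card_fiber_le τ') (by positivity)
      _ = _ := by ring
  have hgood : ∀ i, Fintype.card {v // τ v = i} ≤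
      Fintype.card {j // τ' j = i ∧ s σ j ≤ 2 * (Fintype.card I : ℝ) ^ 2} := by
    intro i
    rw [Fintype.card_subtype, Fintype.card_subtype]
    have hI : (0 : ℝ) < Fintype.card I := by
      have : 0 < Fintype.card I := Fintype.card_pos_iff.2 ⟨i⟩
      exact_mod_cast this
    set T := Finset.univ.filter fun j => τ' j = i with hT
    have hsplit := Finset.card_filter_add_card_filter_not (s := T)
      (fun j => s σ j ≤ 2 * (Fintype.card I : ℝ) ^ 2)
    have hTi : T.filter (fun j => s σ j ≤ 2 * (Fintype.card I : ℝ) ^ 2) =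
        Finset.univ.filter fun j => τ' j = i ∧ s σ j ≤ 2 * (Fintype.card I : ℝ) ^ 2 := by
      rw [hT, Finset.filter_filter]
    rw [hTi] at hsplit
    set B := T.filter (fun j => ¬ s σ j ≤ 2 * (Fintype.card I : ℝ) ^ 2) with hB
    have hbad : (B.card : ℝ) * (2 * (Fintype.card I : ℝ) ^ 2) * (N' i)⁻¹ ≤
        (Fintype.card I : ℝ) ^ 2 := by
      refine le_trans ?_ hσ
      calc _ = ∑ j ∈ B, 2 * (Fintype.card I : ℝ) ^ 2 * (N' i)⁻¹ := by
            rw [Finset.sum_const, nsmul_eq_mul]; ring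
        _ ≤ ∑ j ∈ B, s σ j * (N' (τ' j))⁻¹ := by
            refine Finset.sum_le_sum fun j hj => ?_
            obtain ⟨h1, h2⟩ := Finset.mem_filter.1 hj
            rw [(Finset.mem_filter.1 h1).2]
            exact mul_le_mul_of_nonneg_right (not_le.1 h2).le (by positivity)
        _ ≤ _ := Finset.sum_le_sum_of_subset_of_nonneg (Finset.subset_univ _) fun j _ _ =>
            mul_nonneg (hs0 _ _) (inv_nonneg.2 (hN'pos j).le)
    have hTN : (T.card : ℝ) = 2 * ((Finset.univ.filter fun v' => τ v' = i).card : ℝ) := hN' i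
    have hBle : 2 * (B.card : ℝ) ≤ T.card := by
      rcases B.eq_empty_or_nonempty with h | ⟨j, hj⟩
      · simp [h]
      have hpos : 0 < N' i := by
        have := hN'pos j
        rwa [(Finset.mem_filter.1 (Finset.mem_filter.1 hj).1).2] at this
      rw [← div_eq_mul_inv, div_le_iff₀ hpos] at hbad
      have : N' i = T.card := rfl
      rw [← this]
      have h2 : (0 : ℝ) < (Fintype.card I : ℝ) ^ 2 := by positivity
      nlinarith
    have hBle' : 2 * B.card ≤ T.card := by exact_mod_cast hBle
    have hTN' : T.card = 2 * (Finset.univ.filter fun v' => τ v' = i).card := by exact_mod_cast hTN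
    omega
  have e := fun i => (Function.Embedding.nonempty_of_card_le (hgood i)).some
  let g : α → α × Bool := fun v => (e (τ v) ⟨v, rfl⟩).1
  have hg : ∀ v i (h : τ v = i), g v = (e i ⟨v, h⟩).1 := by
    rintro v i rfl; rfl
  have hgτ : ∀ v, τ' (g v) = τ v := fun v => (e (τ v) ⟨v, rfl⟩).2.1
  have hgs : ∀ v, s σ (g v) ≤ 2 * (Fintype.card I : ℝ) ^ 2 := fun v => (e (τ v) ⟨v, rfl⟩).2.2
  have hginj : Function.Injective g := by
    intro v v' h
    have hτ : τ v' = τ v := by rw [← hgτ, ← hgτ, h]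
    rw [hg v _ rfl, hg v' _ hτ] at h
    exact congrArg Subtype.val ((e (τ v)).injective (Subtype.ext h))
  refine ⟨fun v => σ (g v), fun v i => ?_⟩
  rcases (Finset.univ.filter fun v' => τ v' = i).eq_empty_or_nonempty with hemp | ⟨w, hw⟩
  · have : (Finset.univ.filter fun v' => τ v' = i ∧ v' ≠ v) = ∅ := by
      rw [← Finset.filter_filter, hemp, Finset.filter_empty]
    rw [this, hemp]; simp
  have hNi : 0 < N' i := by
    rw [hN']
    have : 0 < (Finset.univ.filter fun v' => τ v' = i).card := Finset.card_pos.2 ⟨w, hw⟩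
    have : (0 : ℝ) < ((Finset.univ.filter fun v' => τ v' = i).card : ℝ) := by exact_mod_cast this
    linarith
  have hpos : 0 < N' i * b i := mul_pos hNi (hb i)
  have hle : (∑ v' ∈ Finset.univ.filter (fun v' => τ v' = i ∧ v' ≠ v),
      K (τ v) i (σ (g v)) (σ (g v'))) / (N' i * b i) ≤ s σ (g v) := by
    rw [Finset.sum_div]
    calc _ = ∑ v' ∈ Finset.univ.filter (fun v' => τ v' = i ∧ v' ≠ v),
          K (τ' (g v)) (τ' (g v')) (σ (g v)) (σ (g v')) / (N' (τ' (g v')) * b (τ' (g v'))) := by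
          refine Finset.sum_congr rfl fun v' hv' => ?_
          rw [hgτ, hgτ, (Finset.mem_filter.1 hv').2.1]
      _ = ∑ j' ∈ (Finset.univ.filter (fun v' => τ v' = i ∧ v' ≠ v)).image g,
          K (τ' (g v)) (τ' j') (σ (g v)) (σ j') / (N' (τ' j') * b (τ' j')) := by
          rw [Finset.sum_image fun x _ y _ h => hginj h]
      _ ≤ _ := by
          refine Finset.sum_le_sum_of_subset_of_nonneg ?_ fun j' _ _ =>
            div_nonneg (hK0 _ _ _ _) (mul_nonneg (hN'pos j').le (hb _).le)
          intro j' hj'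
          obtain ⟨v', hv', rfl⟩ := Finset.mem_image.1 hj'
          simp only [Finset.mem_filter, Finset.mem_univ, true_and]
          exact fun h => (Finset.mem_filter.1 hv').2.2 (hginj h)
  rw [div_le_iff₀ hpos] at hle
  calc _ ≤ _ := hle
    _ ≤ 2 * (Fintype.card I : ℝ) ^ 2 * (N' i * b i) :=
        mul_le_mul_of_nonneg_right (hgs v) hpos.le
    _ = _ := by rw [hN']; ring

end Expurgation

section UnionBound

variable {V X Y : Type*} [Fintype V] [Fintype X] [Fintype Y] {k n : ℕ}

/-- Bhattacharyya coefficient of two codewords. -/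
def bhattSeq (W : X → Y → ℝ) (x x' : Fin n → X) : ℝ := ∏ l, bhatt W (x l) (x' l)

omit [Fintype X] in
lemma bhattSeq_nonneg (W : X → Y → ℝ) (x x' : Fin n → X) : 0 ≤ bhattSeq W x x' :=
  Finset.prod_nonneg fun _ _ => bhatt_nonneg W _ _

omit [Fintype X] in
lemma bhattSeq_symm (W : X → Y → ℝ) (x x' : Fin n → X) : bhattSeq W x x' = bhattSeq W x' x :=
  Finset.prod_congr rfl fun _ _ => bhatt_symm W _ _

omit [Fintype X] in
lemma bhattSeq_eq_sum {W : X → Y → ℝ} (hW : IsDMC W) (x x' : Fin n → X) :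
    bhattSeq W x x' = ∑ y, Real.sqrt (Wn W x y * Wn W x' y) := by
  simp only [bhattSeq, bhatt]
  rw [Finset.prod_univ_sum, Fintype.piFinset_univ]
  refine Finset.sum_congr rfl fun y _ => ?_
  rw [Wn, Wn, ← Finset.prod_mul_distrib, Real.sqrt_prod]
  exact fun l _ => mul_nonneg ((hW _).1 _) ((hW _).1 _)

/-- Union–Bhattacharyya bound on the error probability of maximum a posteriori decoding. -/
def unionBound (PV : V → ℝ) (W : X → Y → ℝ) (f : (Fin k → V) → Fin n → X) : ℝ :=
  ∑ v, ∑ v' ∈ Finset.univ.filter (fun v' => v' ≠ v),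
    Real.sqrt (prodDist PV v * prodDist PV v') * bhattSeq W (f v) (f v')

omit [Fintype V] in
lemma prodDist_nonneg {PV : V → ℝ} (hPV : ∀ a, 0 ≤ PV a) (v : Fin k → V) : 0 ≤ prodDist PV v :=
  Finset.prod_nonneg fun _ _ => hPV _

omit [Fintype X] in
lemma exists_decoder [Nonempty V] {PV : V → ℝ} (hPV : ∀ a, 0 ≤ PV a) {W : X → Y → ℝ}
    (hW : IsDMC W) (f : (Fin k → V) → Fin n → X) :
    ∃ φ : (Fin n → Y) → Fin k → V, pErr PV W f φ ≤ unionBound PV W f := by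
  have hWn : ∀ x y, 0 ≤ Wn (n := n) W x y := fun x y => Finset.prod_nonneg fun l _ => (hW _).1 _
  choose φ hφ using fun y : Fin n → Y =>
    Finite.exists_max fun v : Fin k → V => prodDist PV v * Wn W (f v) y
  refine ⟨φ, Finset.sum_le_sum fun v _ => ?_⟩
  rw [Finset.mul_sum]
  have hstep : ∀ y ∈ Finset.univ.filter (fun y : Fin n → Y => φ y ≠ v),
      prodDist PV v * Wn W (f v) y ≤ ∑ v' ∈ Finset.univ.filter (fun v' => v' ≠ v),
        Real.sqrt (prodDist PV v * prodDist PV v') *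
          Real.sqrt (Wn W (f v) y * Wn W (f v') y) := by
    intro y hy
    have hy : φ y ≠ v := (Finset.mem_filter.1 hy).2
    refine le_trans ?_ (Finset.single_le_sum (f := fun v' =>
      Real.sqrt (prodDist PV v * prodDist PV v') * Real.sqrt (Wn W (f v) y * Wn W (f v') y))
      (fun v' _ => by positivity) (Finset.mem_filter.2 ⟨Finset.mem_univ (φ y), hy⟩))
    have hp := prodDist_nonneg hPV v
    have hp' := prodDist_nonneg hPV (φ y)
    rw [← Real.sqrt_mul (mul_nonneg hp hp')]
    refine Real.le_sqrt_of_sq_le ?_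
    have h := mul_le_mul_of_nonneg_left (hφ y v) (mul_nonneg hp (hWn (f v) y))
    calc _ = prodDist PV v * Wn W (f v) y * (prodDist PV v * Wn W (f v) y) := by ring
      _ ≤ _ := h
      _ = _ := by ring
  refine (Finset.sum_le_sum hstep).trans ?_
  rw [Finset.sum_comm]
  refine Finset.sum_le_sum fun v' _ => ?_
  rw [← Finset.mul_sum, bhattSeq_eq_sum hW]
  exact mul_le_mul_of_nonneg_left
    (Finset.sum_le_sum_of_subset_of_nonneg (Finset.subset_univ _) fun _ _ _ => Real.sqrt_nonneg _)
    (Real.sqrt_nonneg _)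

lemma sum_le_rpow_sum_rpow {ι : Type*} (s : Finset ι) (z : ι → ℝ) (hz : ∀ i, 0 ≤ z i) {ρ : ℝ}
    (hρ : 1 ≤ ρ) : ∑ i ∈ s, z i ≤ (∑ i ∈ s, z i ^ (1 / ρ)) ^ ρ := by
  have hρ0 : 0 < ρ := by linarith
  set S := ∑ i ∈ s, z i ^ (1 / ρ) with hS
  have hnn : ∀ i, 0 ≤ z i ^ (1 / ρ) := fun i => Real.rpow_nonneg (hz i) _
  have hS0 : 0 ≤ S := Finset.sum_nonneg fun i _ => hnn i
  rcases hS0.eq_or_lt with h0 | h0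
  · have : ∀ i ∈ s, z i = 0 := by
      intro i hi
      have h1 := (Finset.sum_eq_zero_iff_of_nonneg fun i _ => hnn i).1 (hS.symm.trans h0.symm) i hi
      exact (Real.rpow_eq_zero (hz i) (by positivity)).1 h1
    rw [Finset.sum_eq_zero this]
    positivity
  have hle : ∀ i ∈ s, z i ≤ z i ^ (1 / ρ) * S ^ (ρ - 1) := by
    intro i hi
    have h1 : z i ^ (1 / ρ) ≤ S := Finset.single_le_sum (fun i _ => hnn i) hi
    rcases (hz i).eq_or_lt with h | h
    · rw [← h, Real.zero_rpow (by positivity), zero_mul]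
    calc z i = (z i ^ (1 / ρ)) ^ (1 + (ρ - 1)) := by
          rw [← Real.rpow_mul (hz i), add_sub_cancel, one_div_mul_cancel hρ0.ne', Real.rpow_one]
      _ = z i ^ (1 / ρ) * (z i ^ (1 / ρ)) ^ (ρ - 1) := by
          rw [Real.rpow_add (Real.rpow_pos_of_pos h _), Real.rpow_one]
      _ ≤ _ := by
          refine mul_le_mul_of_nonneg_left ?_ (hnn i)
          exact Real.rpow_le_rpow (hnn i) h1 (by linarith)
  calc _ ≤ _ := Finset.sum_le_sum hle
    _ = S * S ^ (ρ - 1) := by rw [← Finset.sum_mul]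
    _ = S ^ ρ := by
      rw [← Real.rpow_one_add' hS0 (by linarith), add_sub_cancel]

/-- The vector of letter counts of a source sequence. -/
def countVec (v : Fin k → V) : V → Fin (k + 1) :=
  fun a => ⟨letterCount v a, Nat.lt_succ_of_le (letterCount_le v a)⟩

lemma prodDist_eq_countVec (PV : V → ℝ) (v : Fin k → V) :
    prodDist PV v = ∏ a, PV a ^ (countVec v a : ℕ) :=
  prod_comp_eq_letterCount v PV

omit [Fintype V] in
lemma empDist_eq_countVec (v : Fin k → V) : empDist v = fun a => ((countVec v a : ℕ) : ℝ) / k := rfl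

/-- Number of source sequences with the given letter counts. -/
def typeCard (i : V → Fin (k + 1)) : ℝ :=
  ((Finset.univ.filter fun v : Fin k → V => countVec v = i).card : ℝ)

lemma typeCard_nonneg (i : V → Fin (k + 1)) : 0 ≤ typeCard i := Nat.cast_nonneg _

/-- Bound on the sum of Bhattacharyya coefficients over a type class. -/
def typeBound (V X : Type*) [Fintype V] [Fintype X] (k n : ℕ) (ρ A N : ℝ) : ℝ :=
  (4 * (Fintype.card (V → Fin (k + 1)) : ℝ) ^ 2 * N *
    ((Real.exp 1 * (n + 1)) ^ Fintype.card X * Real.exp (-(n * A / ρ)))) ^ ρ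

omit [Fintype X] in
lemma unionBound_le_of_forall {PV : V → ℝ} (hPV : ∀ a, 0 ≤ PV a) {W : X → Y → ℝ}
    (f : (Fin k → V) → Fin n → X) (U : (V → Fin (k + 1)) → ℝ) (B : ℝ) (hB0 : 0 ≤ B)
    (hU : ∀ v i, ∑ v' ∈ Finset.univ.filter (fun v' => countVec v' = i ∧ v' ≠ v),
      bhattSeq W (f v) (f v') ≤ U i)
    (hB : ∀ v, prodDist PV v * typeCard (countVec v) * U (countVec v) ≤ B) :
    unionBound PV W f ≤ (Fintype.card (V → Fin (k + 1)) : ℝ) ^ 2 * B := by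
  let p : (V → Fin (k + 1)) → ℝ := fun i => ∏ a, PV a ^ (i a : ℕ)
  have hp0 : ∀ i, 0 ≤ p i := fun i => Finset.prod_nonneg fun a _ => pow_nonneg (hPV a) _
  let D : (V → Fin (k + 1)) → (V → Fin (k + 1)) → ℝ := fun i i' =>
    ∑ v ∈ Finset.univ.filter (fun v => countVec v = i),
      ∑ v' ∈ Finset.univ.filter (fun v' => countVec v' = i' ∧ v' ≠ v), bhattSeq W (f v) (f v')
  have hD0 : ∀ i i', 0 ≤ D i i' := fun i i' =>
    Finset.sum_nonneg fun v _ => Finset.sum_nonneg fun v' _ => bhattSeq_nonneg W _ _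
  have hDsymm : ∀ i i', D i i' = D i' i := by
    intro i i'
    simp only [D]
    rw [Finset.sum_comm' (t' := Finset.univ.filter (fun v' => countVec v' = i'))
      (s' := fun v' => Finset.univ.filter (fun v => countVec v = i ∧ v ≠ v'))]
    · exact Finset.sum_congr rfl fun v _ => Finset.sum_congr rfl fun v' _ => bhattSeq_symm W _ _
    · intro v v'
      simp only [Finset.mem_filter, Finset.mem_univ, true_and]
      constructor
      · rintro ⟨h1, h2, h3⟩
        exact ⟨⟨h1, h3.symm⟩, h2⟩
      · rintro ⟨⟨h1, h3⟩, h2⟩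
        exact ⟨h1, h2, h3.symm⟩
  have hDle : ∀ i i', D i i' ≤ typeCard i * U i' := by
    intro i i'
    refine (Finset.sum_le_sum fun v _ => hU v i').trans (le_of_eq ?_)
    rw [Finset.sum_const, nsmul_eq_mul]
    rfl
  have hmain : ∀ i i', Real.sqrt (p i * p i') * D i i' ≤ B := by
    intro i i'
    by_cases hi : ∃ v : Fin k → V, countVec v = i
    swap
    · have : D i i' = 0 := by
        simp only [D]
        rw [Finset.filter_false_of_mem fun v _ h => hi ⟨v, h⟩, Finset.sum_empty]
      rw [this, mul_zero]; exact hB0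
    by_cases hi' : ∃ v : Fin k → V, countVec v = i'
    swap
    · have : D i i' = 0 := by
        rw [hDsymm]
        simp only [D]
        rw [Finset.filter_false_of_mem fun v _ h => hi' ⟨v, h⟩, Finset.sum_empty]
      rw [this, mul_zero]; exact hB0
    obtain ⟨v, rfl⟩ := hi
    obtain ⟨v', rfl⟩ := hi'
    have h1 := hB v
    have h2 := hB v'
    rw [prodDist_eq_countVec] at h1 h2
    change p (countVec v) * _ * _ ≤ B at h1
    change p (countVec v') * _ * _ ≤ B at h2
    generalize countVec v = i at *
    generalize countVec v' = i' at *
    have hd1 := hDle i i'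
    have hd2 := (hDsymm i i').trans_le (hDle i' i)
    refine abs_le_of_sq_le_sq' ?_ hB0 |>.2
    rw [mul_pow, Real.sq_sqrt (mul_nonneg (hp0 i) (hp0 i'))]
    calc p i * p i' * D i i' ^ 2 = p i * p i' * (D i i' * D i i') := by ring
      _ ≤ p i * p i' * ((typeCard i * U i') * (typeCard i' * U i)) := by
          refine mul_le_mul_of_nonneg_left ?_ (mul_nonneg (hp0 i) (hp0 i'))
          exact mul_le_mul hd1 hd2 (hD0 _ _) ((hD0 _ _).trans hd1)
      _ = (p i * typeCard i * U i) * (p i' * typeCard i' * U i') := by ring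
      _ ≤ B * B := by
          have hU0 : 0 ≤ U i' := (Finset.sum_nonneg fun v' _ => bhattSeq_nonneg W _ _).trans
            (hU v i')
          exact mul_le_mul h1 h2 (mul_nonneg (mul_nonneg (hp0 i') (typeCard_nonneg _)) hU0) hB0
      _ = B ^ 2 := by ring
  have hsum : unionBound PV W f = ∑ i, ∑ i', Real.sqrt (p i * p i') * D i i' := by
    rw [unionBound, ← Finset.sum_fiberwise (s := Finset.univ) (g := countVec)]
    refine Finset.sum_congr rfl fun i _ => ?_
    simp only [D, Finset.mul_sum]
    rw [Finset.sum_comm]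
    refine Finset.sum_congr rfl fun v hv => ?_
    rw [← Finset.sum_fiberwise (s := Finset.univ.filter fun v' => v' ≠ v) (g := countVec)]
    refine Finset.sum_congr rfl fun i' _ => ?_
    rw [Finset.filter_filter]
    refine Finset.sum_congr (by ext; simp [and_comm]) fun v' hv' => ?_
    rw [prodDist_eq_countVec, prodDist_eq_countVec, (Finset.mem_filter.1 hv).2,
      (Finset.mem_filter.1 hv').2.1]
  rw [hsum]
  refine (Finset.sum_le_sum fun i _ => Finset.sum_le_sum fun i' _ => hmain i i').trans
    (le_of_eq ?_)
  simp only [Finset.sum_const, Finset.card_univ, nsmul_eq_mul]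
  ring

/-- Existence of a constant-composition (per class) encoder with a small union bound. -/
lemma exists_encoder [Nonempty V] {PV : V → ℝ} (hPV : ∀ a, 0 ≤ PV a) {W : X → Y → ℝ} (hn : 0 < n)
    {m : ℕ} (c : (V → Fin (k + 1)) → Fin m) (x₀ : Fin m → Fin n → X) (ρ A : Fin m → ℝ)
    (hρ : ∀ j, 1 ≤ ρ j) (hA : ∀ j, IsExpBound W (empDist (x₀ j)) (ρ j) (A j)) (B : ℝ)
    (hB : ∀ v : Fin k → V, prodDist PV v * typeCard (countVec v) *
      typeBound V X k n (ρ (c (countVec v))) (A (c (countVec v))) (typeCard (countVec v)) ≤ B) :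
    ∃ f : (Fin k → V) → Fin n → X,
      (∀ v, empDist (f v) = empDist (x₀ (c (countVec v)))) ∧
      unionBound PV W f ≤ (Fintype.card (V → Fin (k + 1)) : ℝ) ^ 2 * B := by
  have hρ0 : ∀ j, 0 < ρ j := fun j => by linarith [hρ j]
  let b : (V → Fin (k + 1)) → ℝ := fun i =>
    (Real.exp 1 * (n + 1)) ^ Fintype.card X * Real.exp (-(n * A (c i) / ρ (c i)))
  obtain ⟨g, hg⟩ := exists_expurgated (G := Equiv.Perm (Fin n)) (countVec (V := V) (k := k))
    (fun i i' σ σ' => ∏ l, bhatt W (x₀ (c i) (σ l)) (x₀ (c i') (σ' l)) ^ (1 / ρ (c i')))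
    (fun i i' σ σ' => Finset.prod_nonneg fun l _ => Real.rpow_nonneg (bhatt_nonneg W _ _) _)
    b (fun i => by positivity) (by
      intro i i' σ'
      rw [Fintype.card_perm, Fintype.card_fin]
      have h := hA (c i')
      rw [← empDist_comp_perm _ σ'] at h
      refine le_trans (le_of_eq ?_) (h.sum_perm_le hn (hρ0 _) (x₀ (c i)))
      refine Finset.sum_congr rfl fun σ _ => Finset.prod_congr rfl fun l _ => ?_
      rw [bhatt_symm]
      rfl)
  refine ⟨fun v => x₀ (c (countVec v)) ∘ g v, fun v => empDist_comp_perm _ _, ?_⟩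
  refine unionBound_le_of_forall hPV _
    (fun i => typeBound V X k n (ρ (c i)) (A (c i)) (typeCard i)) B ?_ ?_ hB
  · refine le_trans ?_ (hB fun _ => Classical.arbitrary V)
    refine mul_nonneg (mul_nonneg (prodDist_nonneg hPV _) (typeCard_nonneg _)) ?_
    refine Real.rpow_nonneg ?_ _
    have := typeCard_nonneg (countVec fun _ : Fin k => Classical.arbitrary V)
    positivity
  · intro v i
    refine (sum_le_rpow_sum_rpow _ _ (fun v' => bhattSeq_nonneg W _ _) (hρ (c i))).trans ?_
    refine Real.rpow_le_rpow (Finset.sum_nonneg fun v' _ => Real.rpow_nonneg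
      (bhattSeq_nonneg W _ _) _) ((le_of_eq ?_).trans ((hg v i).trans (le_of_eq ?_))) (hρ0 _).le
    swap
    · simp only [typeCard, b]
      congr!
    refine Finset.sum_congr (by ext; simp) fun v' hv' => ?_
    have hc : countVec v' = i ∧ v' ≠ v := by simpa using hv'
    rw [bhattSeq, ← Real.finsetProd_rpow _ _ fun l _ => bhatt_nonneg W _ _, hc.1]
    rfl

end UnionBound

section SourceTypes

variable {V : Type*} [Fintype V] {k : ℕ}

lemma prodDist_eq_exp {P : V → ℝ} (v : Fin k → V) (hP : ∀ l, 0 < P (v l)) :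
    prodDist P v = Real.exp (k * ∑ a, empDist v a * Real.log (P a)) := by
  rw [← sum_comp_eq_empDist v fun a => Real.log (P a), Real.exp_sum]
  exact Finset.prod_congr rfl fun l _ => (Real.exp_log (hP l)).symm

lemma typeCard_le_exp (v : Fin k → V) :
    typeCard (countVec v) ≤ Real.exp (k * entH (empDist v)) := by
  rcases Nat.eq_zero_or_pos k with rfl | hk
  · simp only [Nat.cast_zero, zero_mul, Real.exp_zero, typeCard]
    have : (Finset.univ.filter fun v' : Fin 0 → V => countVec v' = countVec v).card ≤ 1 :=
      (Finset.card_filter_le _ _).trans (by simp)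
    exact_mod_cast this
  have hv : ∀ v' : Fin k → V, countVec v' = countVec v →
      prodDist (empDist v) v' = Real.exp (-(k * entH (empDist v))) := by
    intro v' h
    have he : empDist v' = empDist v := by rw [empDist_eq_countVec, empDist_eq_countVec, h]
    rw [← he, prodDist_eq_exp, entH]
    · congr 1; ring
    · intro l
      have : 0 < (Finset.univ.filter fun i => v' i = v' l).card :=
        Finset.card_pos.2 ⟨l, by simp⟩
      unfold empDist
      positivity
  have h1 : ∑ v' : Fin k → V, prodDist (empDist v) v' = 1 := by
    have := Finset.prod_univ_sum (fun _ : Fin k => (Finset.univ : Finset V))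
      fun _ a => empDist v a
    rw [Fintype.piFinset_univ] at this
    simp only [prodDist]
    rw [← this, (empDist_mem_stdSimplex hk v).2]
    simp
  have h2 : typeCard (countVec v) * Real.exp (-(k * entH (empDist v))) ≤ 1 := by
    rw [← h1, typeCard, ← nsmul_eq_mul, ← Finset.sum_const]
    refine (Finset.sum_congr rfl fun v' hv' =>
      (hv v' (Finset.mem_filter.1 hv').2).symm).trans_le ?_
    exact Finset.sum_le_sum_of_subset_of_nonneg (Finset.subset_univ _) fun v' _ _ =>
      prodDist_nonneg (empDist_mem_stdSimplex hk v).1 v'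
  rw [Real.exp_neg, ← div_eq_mul_inv, div_le_one (Real.exp_pos _)] at h2
  exact h2

lemma empDist_mem_acSet {PV : V → ℝ} (hk : 0 < k) {v : Fin k → V} (hv : prodDist PV v ≠ 0) :
    empDist v ∈ acSet PV := by
  refine ⟨empDist_mem_stdSimplex hk v, fun a ha => ?_⟩
  rw [empDist, Finset.filter_false_of_mem]
  · simp
  · rintro l - rfl
    exact hv (Finset.prod_eq_zero (Finset.mem_univ l) ha)

/-- Probability of a source type class. -/
lemma prodDist_mul_typeCard_le {PV : V → ℝ} (hPV : ∀ a, 0 ≤ PV a) (v : Fin k → V)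
    (hv : prodDist PV v ≠ 0) :
    prodDist PV v * typeCard (countVec v) ≤ Real.exp (-(k * srcDiv PV (empDist v))) := by
  have hpos : ∀ l, 0 < PV (v l) := fun l => (hPV _).lt_of_ne fun h =>
    hv (Finset.prod_eq_zero (Finset.mem_univ l) h.symm)
  calc _ ≤ prodDist PV v * Real.exp (k * entH (empDist v)) :=
        mul_le_mul_of_nonneg_left (typeCard_le_exp v) (prodDist_nonneg hPV v)
    _ = _ := by
        rw [prodDist_eq_exp v hpos, ← Real.exp_add, srcDiv]
        congr 1
        ring

end SourceTypes

section Approximation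

variable {α : Type*} [Fintype α]

lemma exists_letterCount_eq {n : ℕ} (m : α → ℕ) (hm : ∑ a, m a = n) :
    ∃ v : Fin n → α, ∀ a, letterCount v a = m a := by
  have hcard : Fintype.card (Fin n) = Fintype.card (Σ a, Fin (m a)) := by
    simp [hm]
  let e := Fintype.equivOfCardEq hcard
  refine ⟨fun i => (e i).1, fun a => ?_⟩
  rw [letterCount, ← Fintype.card_subtype]
  rw [Fintype.card_congr (Equiv.subtypeEquiv e (p := fun i => (e i).1 = a)
    (q := fun s => s.1 = a) fun i => Iff.rfl), Fintype.card_congr (Equiv.sigmaSubtype a)]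
  simp

/-- Every distribution is a limit of types. -/
lemma eventually_exists_empDist_near [Nonempty α] {S : α → ℝ} (hS : S ∈ stdSimplex ℝ α) {δ : ℝ}
    (hδ : 0 < δ) : ∀ᶠ n : ℕ in atTop, ∃ v : Fin n → α, ∀ a, |empDist v a - S a| ≤ δ := by
  have h1 : ∀ᶠ n : ℕ in atTop, (Fintype.card α : ℝ) / δ ≤ n :=
    tendsto_natCast_atTop_atTop.eventually_ge_atTop _
  filter_upwards [h1, eventually_gt_atTop 0] with n hn hn0
  have hn' : (0 : ℝ) < n := by positivity
  let F : α → ℕ := fun a => ⌊n * S a⌋₊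
  have hFle : ∀ a, (F a : ℝ) ≤ n * S a := fun a => Nat.floor_le (mul_nonneg hn'.le (hS.1 a))
  have hFlt : ∀ a, n * S a ≤ F a + 1 := fun a => (Nat.lt_floor_add_one _).le
  have hsum : ∑ a, (n * S a : ℝ) = n := by rw [← Finset.mul_sum, hS.2, mul_one]
  have hFn : ∑ a, F a ≤ n := by
    have : (∑ a, (F a : ℝ)) ≤ n := hsum ▸ Finset.sum_le_sum fun a _ => hFle a
    exact_mod_cast this
  obtain ⟨r, hr⟩ := Nat.exists_eq_add_of_le hFn
  have hrle : (r : ℝ) ≤ Fintype.card α := by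
    have h2 : (n : ℝ) ≤ ∑ a, ((F a : ℝ) + 1) := by
      conv_lhs => rw [← hsum]
      exact Finset.sum_le_sum fun a _ => hFlt a
    have h3 : (n : ℝ) = ∑ a, (F a : ℝ) + r := by exact_mod_cast hr
    rw [Finset.sum_add_distrib] at h2
    simp only [Finset.sum_const, Finset.card_univ, nsmul_eq_mul, mul_one] at h2
    linarith
  let a₀ : α := Classical.arbitrary α
  obtain ⟨v, hv⟩ := exists_letterCount_eq (n := n) (fun a => F a + if a = a₀ then r else 0) (by
    rw [Finset.sum_add_distrib, Finset.sum_ite_eq' Finset.univ a₀]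
    simpa using hr.symm)
  refine ⟨v, fun a => ?_⟩
  have hcard : (1 : ℝ) ≤ Fintype.card α := by exact_mod_cast Fintype.card_pos (α := α)
  have hcnt : |(letterCount v a : ℝ) - n * S a| ≤ Fintype.card α := by
    rw [hv, abs_le]
    push_cast
    have h4 : (0 : ℝ) ≤ (if a = a₀ then (r : ℝ) else 0) ∧ (if a = a₀ then (r : ℝ) else 0) ≤ r := by
      split_ifs <;> simp
    constructor
    · linarith [hFlt a, h4.1]
    · linarith [hFle a, h4.2]
  have he : empDist v a - S a = ((letterCount v a : ℝ) - n * S a) / n := by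
    rw [sub_div, mul_div_cancel_left₀ _ hn'.ne']; rfl
  rw [he, abs_div, abs_of_pos hn', div_le_iff₀ hn']
  rw [div_le_iff₀ hδ] at hn
  linarith

lemma eventually_mul_pow_le_exp (K : ℝ) (p : ℕ) {η : ℝ} (hη : 0 < η) :
    ∀ᶠ n : ℕ in atTop, K * ((n : ℝ) + 1) ^ p ≤ Real.exp (η * n) := by
  have h1 := (isLittleO_pow_exp_pos_mul_atTop p hη).comp_tendsto
    (tendsto_atTop_add_const_right atTop (1 : ℝ) tendsto_natCast_atTop_atTop)
  have hc : 0 < ((|K| + 1) * Real.exp η)⁻¹ := by positivity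
  filter_upwards [h1.def hc] with n hn
  simp only [Function.comp_apply, Real.norm_eq_abs, Real.abs_exp] at hn
  rw [abs_of_nonneg (by positivity)] at hn
  calc K * ((n : ℝ) + 1) ^ p ≤ (|K| + 1) * ((n : ℝ) + 1) ^ p := by
        gcongr
        linarith [le_abs_self K]
    _ ≤ (|K| + 1) * (((|K| + 1) * Real.exp η)⁻¹ * Real.exp (η * (n + 1))) := by gcongr
    _ = Real.exp (η * n) := by
        rw [mul_add, mul_one, Real.exp_add]
        field_simp

lemma exists_pos_le_of_pos {ι : Type*} [Finite ι] (g : ι → ℝ) :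
    ∃ p : ℝ, 0 < p ∧ p ≤ 1 ∧ ∀ i, 0 < g i → p ≤ g i := by
  let h : Option ι → ℝ := fun o => o.elim 1 fun i => if 0 < g i then g i else 1
  obtain ⟨o, ho⟩ := Finite.exists_min h
  have hpos : ∀ o, 0 < h o := by
    rintro (_ | i)
    · exact one_pos
    · simp only [h, Option.elim]
      split_ifs with hi
      exacts [hi, one_pos]
  refine ⟨h o, hpos o, ho none, fun i hi => (ho (some i)).trans (le_of_eq ?_)⟩
  simp [h, hi]

end Approximation

section Coding

variable {V X Y : Type*} [Fintype V] [Fintype X] [Fintype Y]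

lemma typeBound_le {k n : ℕ} {ρ A N H ρm : ℝ} (hρ : 1 ≤ ρ) (hρm : ρ ≤ ρm) (hN0 : 0 ≤ N)
    (hN : N ≤ Real.exp (k * H)) :
    typeBound V X k n ρ A N ≤ (4 * (Fintype.card (V → Fin (k + 1)) : ℝ) ^ 2 *
      (Real.exp 1 * (n + 1)) ^ Fintype.card X) ^ ρm * Real.exp (ρ * (k * H) - n * A) := by
  set a : ℝ := 4 * (Fintype.card (V → Fin (k + 1)) : ℝ) ^ 2 *
    (Real.exp 1 * (n + 1)) ^ Fintype.card X with ha
  have hρ0 : 0 < ρ := by linarith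
  have ha1 : 1 ≤ a := by
    have hI : (1 : ℝ) ≤ Fintype.card (V → Fin (k + 1)) := by
      exact_mod_cast Fintype.card_pos (α := V → Fin (k + 1))
    have h1 : (1 : ℝ) ≤ (Fintype.card (V → Fin (k + 1)) : ℝ) ^ 2 := one_le_pow₀ hI
    have h2 : (1 : ℝ) ≤ (Real.exp 1 * (n + 1)) ^ Fintype.card X := by
      refine one_le_pow₀ (one_le_mul_of_one_le_of_one_le (Real.one_le_exp zero_le_one) ?_)
      linarith [Nat.cast_nonneg (α := ℝ) n]
    nlinarith
  calc typeBound V X k n ρ A N = (a * (N * Real.exp (-(n * A / ρ)))) ^ ρ := by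
        rw [typeBound, ha]; congr 1; ring
    _ ≤ (a * (Real.exp (k * H) * Real.exp (-(n * A / ρ)))) ^ ρ := by gcongr
    _ = a ^ ρ * Real.exp (ρ * (k * H) - n * A) := by
        rw [Real.mul_rpow (by positivity) (by positivity), ← Real.exp_add, ← Real.exp_mul]
        congr 2
        field_simp
        ring
    _ ≤ _ := by
        gcongr

lemma eventually_exists_type_gt [Nonempty V] {t R : ℝ} {S : V → ℝ}
    (hS : S ∈ stdSimplex ℝ V) (hR : R < t * entH S) :
    ∀ᶠ k : ℕ in atTop, ∃ v : Fin k → V, R < t * entH (empDist v) := by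
  have hopen : IsOpen {S' : V → ℝ | R < t * entH S'} :=
    isOpen_lt continuous_const (continuous_const.mul continuous_entH)
  obtain ⟨δ, hδ, hball⟩ := Metric.isOpen_iff.1 hopen S hR
  filter_upwards [eventually_exists_empDist_near hS (half_pos hδ)] with k ⟨v, hv⟩
  refine ⟨v, hball ?_⟩
  refine lt_of_le_of_lt ((dist_pi_le_iff (by positivity)).2 fun x => ?_) (half_lt_self hδ)
  rw [Real.dist_eq]
  exact hv x

lemma entH_empDist_const {k : ℕ} (a : V) : entH (empDist fun _ : Fin k => a) = 0 := by
  rw [entH_eq_sum_negMulLog]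
  refine Finset.sum_eq_zero fun b _ => ?_
  have hk : ((k : ℝ) / k) = 0 ∨ ((k : ℝ) / k) = 1 := by
    rcases eq_or_ne (k : ℝ) 0 with h | h
    · left; simp [h]
    · right; exact div_self h
  by_cases h : a = b
  · rcases hk with hk | hk <;> simp [empDist, h, hk]
  · simp [empDist, h]

/-- Achievability of any exponent for which a good pair of input distributions exists. -/
lemma IsGoodPair.eventually_exists_code [Nonempty V] [Nonempty X] {PV : V → ℝ}
    (hPV : ∀ a, 0 ≤ PV a) {W : X → Y → ℝ} (hW : IsDMC W) {t M : ℝ} (ht : 0 < t)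
    {Q : Fin 2 → X → ℝ} {ρ A : Fin 2 → ℝ} {R : ℝ} (h : IsGoodPair PV W t M Q ρ A R) {δ η : ℝ}
    (hδ : 0 < δ) (hη : 0 < η) :
    ∀ᶠ n : ℕ in atTop, ∃ (cls : (Fin ⌊t * (n : ℝ)⌋₊ → V) → Fin 2) (Qc : Fin 2 → X → ℝ),
      IsTypePartition cls ∧ (∀ c, (typeClass n (Qc c)).Nonempty) ∧
      (∀ c x, |Qc c x - Q c x| ≤ δ) ∧
      ∃ (f : (Fin ⌊t * (n : ℝ)⌋₊ → V) → Fin n → X)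
        (φ : (Fin n → Y) → Fin ⌊t * (n : ℝ)⌋₊ → V),
        (∀ v, f v ∈ typeClass n (Qc (cls v))) ∧ pErr PV W f φ ≤ unionBound PV W f ∧
        unionBound PV W f ≤ Real.exp (-(n * (M - η))) := by
  choose δ' hδ' hnear using fun c => (h.bound c).exists_nhds
  obtain ⟨C, hC⟩ := (isCompact_acSet PV).exists_bound_of_continuousOn
    (continuous_srcDiv PV).continuousOn
  set ρm := max (ρ 0) (ρ 1) with hρm
  have hρle : ∀ c, ρ c ≤ ρm := Fin.forall_fin_two.2 ⟨le_max_left _ _, le_max_right _ _⟩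
  have hρm1 : 1 ≤ ρm := (h.one_le 0).trans (hρle 0)
  have hρm0 : 0 < ρm := by linarith
  have hfloor : Tendsto (fun n : ℕ => ⌊t * (n : ℝ)⌋₊) atTop atTop :=
    tendsto_nat_floor_atTop.comp (tendsto_natCast_atTop_atTop.const_mul_atTop ht)
  have hsurj : Nontrivial V → ∀ᶠ n : ℕ in atTop, ∃ v : Fin ⌊t * (n : ℝ)⌋₊ → V,
      R < t * entH (empDist v) := by
    intro hV
    obtain ⟨S, hS, hSR⟩ := h.exists_lt hV
    exact hfloor.eventually (eventually_exists_type_gt hS hSR)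
  have hsurj' : ∀ᶠ n : ℕ in atTop, Nontrivial V → ∃ v : Fin ⌊t * (n : ℝ)⌋₊ → V,
      R < t * entH (empDist v) := by
    by_cases hV : Nontrivial V
    · filter_upwards [hsurj hV] with n hn _ using hn
    · exact Eventually.of_forall fun n hV' => absurd hV' hV
  have happ : ∀ᶠ n : ℕ in atTop, ∀ c, ∃ x : Fin n → X,
      ∀ a, |empDist x a - Q c a| ≤ min δ (δ' c) :=
    eventually_all.2 fun c => eventually_exists_empDist_near (h.mem c) (lt_min hδ (hδ' c))
  set d := Fintype.card V with hd
  have hs1 := eventually_mul_pow_le_exp ((t + 1) ^ (d * 2)) (d * 2)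
    (show 0 < η / 3 by positivity)
  have hs2 := eventually_mul_pow_le_exp
    (4 * (t + 1) ^ (d * 2) * Real.exp 1 ^ Fintype.card X) (d * 2 + Fintype.card X)
    (show 0 < η / 3 / ρm by positivity)
  have hs3 := eventually_mul_pow_le_exp (Real.exp C) 0 (show 0 < η / 3 by positivity)
  filter_upwards [hsurj', happ, hs1, hs2, hs3, eventually_gt_atTop 0,
    hfloor.eventually_gt_atTop 0] with n hsurj happ hs1 hs2 hs3 hn hk
  have hkle : ((⌊t * (n : ℝ)⌋₊ : ℕ) : ℝ) ≤ t * n := Nat.floor_le (by positivity)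
  have hklt : t * (n : ℝ) ≤ (⌊t * (n : ℝ)⌋₊ : ℕ) + 1 := (Nat.lt_floor_add_one _).le
  generalize ⌊t * (n : ℝ)⌋₊ = k at *
  choose x₀ hx₀ using happ
  let c : (V → Fin (k + 1)) → Fin 2 := fun i =>
    if t * entH (fun a => ((i a : ℕ) : ℝ) / k) ≤ R then 0 else 1
  have hcls : ∀ v : Fin k → V, c (countVec v) = if t * entH (empDist v) ≤ R then 0 else 1 :=
    fun v => rfl
  set I : ℝ := (Fintype.card (V → Fin (k + 1)) : ℝ) with hI
  set a : ℝ := 4 * I ^ 2 * (Real.exp 1 * (n + 1)) ^ Fintype.card X with ha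
  have hI0 : 0 ≤ I := Nat.cast_nonneg _
  have ha0 : 0 ≤ a := by positivity
  set B : ℝ := a ^ ρm * Real.exp (C - n * M) with hB
  have hn' : (0 : ℝ) < n := by positivity
  obtain ⟨f, hf, hfB⟩ := exists_encoder (k := k) hPV (W := W) hn c x₀ ρ A h.one_le
    (fun j => hnear j _ fun x => (hx₀ j x).trans (min_le_right _ _)) B (by
      intro v
      rcases eq_or_ne (prodDist PV v) 0 with h0 | h0
      · rw [h0, zero_mul, zero_mul]; positivity
      have hac := empDist_mem_acSet hk h0
      have hD := abs_le.1 (hC _ hac)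
      have hH := entH_nonneg hac.1
      have hexp : M < t * srcDiv PV (empDist v) + A (c (countVec v)) -
          ρ (c (countVec v)) * (t * entH (empDist v)) := by
        rw [hcls]
        split_ifs with hle
        · exact h.low _ hac hle
        · exact h.high _ hac (not_le.1 hle)
      have hρ1 := h.one_le (c (countVec v))
      have hρ2 := hρle (c (countVec v))
      generalize c (countVec v) = j at *
      calc _ ≤ Real.exp (-(k * srcDiv PV (empDist v))) *
            (a ^ ρm * Real.exp (ρ j * (k * entH (empDist v)) - n * A j)) := by
            refine mul_le_mul (prodDist_mul_typeCard_le hPV v h0)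
              (typeBound_le hρ1 hρ2 (typeCard_nonneg _) (typeCard_le_exp v))
              (Real.rpow_nonneg ?_ _) (Real.exp_pos _).le
            have := typeCard_nonneg (countVec v)
            positivity
        _ = a ^ ρm * Real.exp (-(k * srcDiv PV (empDist v)) +
            (ρ j * (k * entH (empDist v)) - n * A j)) := by rw [Real.exp_add]; ring
        _ ≤ B := by
            rw [hB]
            gcongr
            have e1 : ρ j * (k * entH (empDist v)) ≤ ρ j * (t * n * entH (empDist v)) := by
              gcongr
            have e2 : (t * n - k) * srcDiv PV (empDist v) ≤ C := by
              have hb1 : 0 ≤ t * n - (k : ℝ) := by linarith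
              have hb2 : t * n - (k : ℝ) ≤ 1 := by linarith
              have hC0 : 0 ≤ C := by linarith [hD.1, hD.2]
              nlinarith [hD.1, hD.2]
            nlinarith [mul_le_mul_of_nonneg_left hexp.le hn'.le])
  obtain ⟨φ, hφ⟩ := exists_decoder hPV hW f
  refine ⟨fun v => c (countVec v), fun j => empDist (x₀ j), ⟨?_, ?_⟩, fun j => ⟨x₀ j, rfl⟩,
    fun j x => (hx₀ j x).trans (min_le_left _ _), f, φ, hf, hφ, hfB.trans ?_⟩
  · intro v v' hvv
    simp only [hcls, hvv]
  · intro hV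
    refine Fin.forall_fin_two.2 ⟨⟨fun _ => Classical.arbitrary V, ?_⟩, ?_⟩
    · simp only [hcls, entH_empDist_const, mul_zero]
      rw [if_pos h.nonneg]
    · obtain ⟨v, hv⟩ := hsurj hV
      refine ⟨v, ?_⟩
      simp only [hcls]
      rw [if_neg (not_le.2 hv)]
  · have hIle : I ^ 2 ≤ (t + 1) ^ (d * 2) * ((n : ℝ) + 1) ^ (d * 2) := by
      have h1 : I = ((k : ℝ) + 1) ^ d := by
        rw [hI, hd]; simp
      rw [h1, ← pow_mul, ← mul_pow]
      gcongr
      nlinarith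
    have hale : a ≤ Real.exp (η / 3 / ρm * n) := by
      refine le_trans ?_ hs2
      calc a ≤ 4 * ((t + 1) ^ (d * 2) * ((n : ℝ) + 1) ^ (d * 2)) *
            (Real.exp 1 * (n + 1)) ^ Fintype.card X := by rw [ha]; gcongr
        _ = _ := by rw [mul_pow (Real.exp 1), pow_add]; ring
    have haρ : a ^ ρm ≤ Real.exp (η / 3 * n) := by
      calc a ^ ρm ≤ Real.exp (η / 3 / ρm * n) ^ ρm := by gcongr
        _ = _ := by rw [← Real.exp_mul]; congr 1; field_simp
    rw [pow_zero, mul_one] at hs3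
    calc I ^ 2 * B ≤ Real.exp (η / 3 * n) * (Real.exp (η / 3 * n) *
          (Real.exp (η / 3 * n) * Real.exp (-(n * M)))) := by
          rw [hB, sub_eq_add_neg, Real.exp_add]
          gcongr
          exact hIle.trans hs1
      _ = _ := by
          rw [← Real.exp_add, ← Real.exp_add, ← Real.exp_add]
          congr 1
          ring

/-- A union bound below the smallest possible nonzero term vanishes. -/
lemma exists_forall_unionBound_eq_zero {PV : V → ℝ} (hPV : PV ∈ stdSimplex ℝ V) (W : X → Y → ℝ)
    (t : ℝ) : ∃ L : ℝ, ∀ {k n : ℕ}, (k : ℝ) ≤ t * n →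
      ∀ f : (Fin k → V) → Fin n → X, unionBound PV W f < Real.exp (-(n * L)) →
        unionBound PV W f ≤ 0 := by
  obtain ⟨p, hp0, hp1, hp⟩ := exists_pos_le_of_pos PV
  obtain ⟨z, hz0, -, hz⟩ := exists_pos_le_of_pos fun q : X × X => bhatt W q.1 q.2
  refine ⟨-(t * Real.log p + Real.log z), fun {k n} hk f hlt => ?_⟩
  by_contra hcon
  have hterm0 : ∀ v v', 0 ≤ Real.sqrt (prodDist PV v * prodDist PV v') * bhattSeq W (f v) (f v') :=
    fun v v' => mul_nonneg (Real.sqrt_nonneg _) (bhattSeq_nonneg W _ _)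
  have hpos := not_le.1 hcon
  rw [unionBound, ← Finset.sum_const_zero (s := (Finset.univ : Finset (Fin k → V)))] at hpos
  obtain ⟨v, -, hv⟩ := Finset.exists_lt_of_sum_lt hpos
  obtain ⟨v', hv', hvv⟩ := Finset.exists_lt_of_sum_lt (f := fun _ => (0 : ℝ)) (by simpa using hv)
  have hle : Real.sqrt (prodDist PV v * prodDist PV v') * bhattSeq W (f v) (f v') ≤
      unionBound PV W f := by
    refine (Finset.single_le_sum (f := fun v' =>
      Real.sqrt (prodDist PV v * prodDist PV v') * bhattSeq W (f v) (f v'))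
      (fun w _ => hterm0 v w) hv').trans ?_
    exact Finset.single_le_sum (f := fun v => ∑ v' ∈ Finset.univ.filter (fun v' => v' ≠ v),
      Real.sqrt (prodDist PV v * prodDist PV v') * bhattSeq W (f v) (f v'))
      (fun w _ => Finset.sum_nonneg fun w' _ => hterm0 w w') (Finset.mem_univ v)
  have hbz : z ^ n ≤ bhattSeq W (f v) (f v') := by
    have hne : bhattSeq W (f v) (f v') ≠ 0 := right_ne_zero_of_mul hvv.ne'
    calc z ^ n = ∏ _l : Fin n, z := by simp
      _ ≤ _ := Finset.prod_le_prod (fun _ _ => hz0.le) fun l _ => hz (f v l, f v' l)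
        ((bhatt_nonneg W _ _).lt_of_ne fun h0 =>
          hne (Finset.prod_eq_zero (Finset.mem_univ l) h0.symm))
  have hpd : ∀ w : Fin k → V, prodDist PV w ≠ 0 → p ^ k ≤ prodDist PV w := by
    intro w hw
    calc p ^ k = ∏ _l : Fin k, p := by simp
      _ ≤ _ := Finset.prod_le_prod (fun _ _ => hp0.le) fun l _ => hp _
        ((hPV.1 _).lt_of_ne fun h0 => hw (Finset.prod_eq_zero (Finset.mem_univ l) h0.symm))
  have hsq : p ^ k ≤ Real.sqrt (prodDist PV v * prodDist PV v') := by
    have hne : prodDist PV v * prodDist PV v' ≠ 0 := fun h0 => by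
      simp [h0] at hvv
    refine Real.le_sqrt_of_sq_le ?_
    rw [sq]
    exact mul_le_mul (hpd v (left_ne_zero_of_mul hne)) (hpd v' (right_ne_zero_of_mul hne))
      (by positivity) (prodDist_nonneg hPV.1 v)
  have hfin : Real.exp (-(n * -(t * Real.log p + Real.log z))) ≤ p ^ k * z ^ n := by
    have e1 : p ^ k = Real.exp (k * Real.log p) := by
      rw [mul_comm, Real.exp_mul, Real.exp_log hp0, Real.rpow_natCast]
    have e2 : z ^ n = Real.exp (n * Real.log z) := by
      rw [mul_comm, Real.exp_mul, Real.exp_log hz0, Real.rpow_natCast]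
    rw [e1, e2, ← Real.exp_add, Real.exp_le_exp]
    have := mul_le_mul_of_nonpos_right hk (Real.log_nonpos hp0.le hp1)
    linarith
  have := mul_le_mul hsq hbz (by positivity) (Real.sqrt_nonneg _)
  linarith

lemma IsGoodPair.mono {PV : V → ℝ} {W : X → Y → ℝ} {t M M' : ℝ} {Q : Fin 2 → X → ℝ}
    {ρ A : Fin 2 → ℝ} {R : ℝ} (h : IsGoodPair PV W t M Q ρ A R) (hM : M' ≤ M) :
    IsGoodPair PV W t M' Q ρ A R :=
  ⟨h.mem, h.one_le, h.bound, h.nonneg, h.exists_lt, fun S hS hle => hM.trans_lt (h.low S hS hle),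
    fun S hS hlt => hM.trans_lt (h.high S hS hlt)⟩

/-- One limiting pair of input distributions serves all exponents below `EJ2ex`. -/
lemma exists_limit_pair [Nonempty X] (PV : V → ℝ) {W : X → Y → ℝ} (hW : IsDMC W) {t : ℝ}
    (ht : 0 < t) : ∃ Q : Fin 2 → X → ℝ, (∀ c, Q c ∈ stdSimplex ℝ X) ∧
      ∀ M : ℝ, (M : EReal) < EJ2ex PV W t → ∀ δ > 0, ∃ Q' ρ A R,
        IsGoodPair PV W t M Q' ρ A R ∧ ∀ c x, |Q' c x - Q c x| ≤ δ := by
  let ι := {M : ℝ // (M : EReal) < EJ2ex PV W t}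
  let G : ι → Set (Fin 2 → X → ℝ) := fun M => {Q | ∃ ρ A R, IsGoodPair PV W t M.1 Q ρ A R}
  let K : Set (Fin 2 → X → ℝ) := Set.univ.pi fun _ => stdSimplex ℝ X
  have hK : IsCompact K := isCompact_univ_pi fun _ => isCompact_stdSimplex ℝ X
  have hGK : ∀ M, closure (G M) ⊆ K := fun M =>
    closure_minimal (fun Q hQ c _ => by obtain ⟨ρ, A, R, h⟩ := hQ; exact h.mem c) hK.isClosed
  have : Nonempty ι := by
    obtain ⟨M, hM⟩ := exists_real_lt_EJ2ex PV hW ht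
    exact ⟨⟨M, hM⟩⟩
  have hne : (⋂ M, closure (G M)).Nonempty := by
    refine IsCompact.nonempty_iInter_of_directed_nonempty_isCompact_isClosed _ ?_ ?_ ?_ ?_
    · intro M M'
      rcases le_total M.1 M'.1 with h | h
      · exact ⟨M', closure_mono fun Q ⟨ρ, A, R, hQ⟩ => ⟨ρ, A, R, hQ.mono h⟩, subset_rfl⟩
      · exact ⟨M, subset_rfl, closure_mono fun Q ⟨ρ, A, R, hQ⟩ => ⟨ρ, A, R, hQ.mono h⟩⟩
    · intro M
      obtain ⟨Q, ρ, A, R, h⟩ := exists_isGoodPair ht M.2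
      exact ⟨Q, subset_closure ⟨ρ, A, R, h⟩⟩
    · exact fun M => hK.of_isClosed_subset isClosed_closure (hGK M)
    · exact fun M => isClosed_closure
  obtain ⟨Q, hQ⟩ := hne
  rw [Set.mem_iInter] at hQ
  refine ⟨Q, fun c => hGK (Classical.arbitrary ι) (hQ _) c (Set.mem_univ _), fun M hM δ hδ => ?_⟩
  obtain ⟨Q', ⟨ρ, A, R, hQ'⟩, hdist⟩ := Metric.mem_closure_iff.1 (hQ ⟨M, hM⟩) δ hδ
  refine ⟨Q', ρ, A, R, hQ', fun c x => ?_⟩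
  rw [← Real.dist_eq, dist_comm]
  exact ((dist_le_pi_dist (Q c) (Q' c) x).trans (dist_le_pi_dist Q Q' c)).trans hdist.le

end Coding
end

theorem stmt11 {V X Y : Type*} [Fintype V] [Fintype X] [Nonempty X] [Fintype Y]
    (PV : V → ℝ) (hPV : PV ∈ stdSimplex ℝ V) (W : X → Y → ℝ) (hW : IsDMC W)
    (t : ℝ) (ht : 0 < t) :
    ∃ Q₁ ∈ stdSimplex ℝ X, ∃ Q₂ ∈ stdSimplex ℝ X,
      ∀ ε : ℝ, 0 < ε → ∃ n₀ : ℕ, ∀ n : ℕ, n₀ ≤ n →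
        ∃ (cls : (Fin ⌊t * (n : ℝ)⌋₊ → V) → Fin 2) (Qc : Fin 2 → X → ℝ),
          IsTypePartition cls ∧
          (∀ c, (typeClass n (Qc c)).Nonempty) ∧
          (∀ x, |Qc 0 x - Q₁ x| ≤ ε) ∧ (∀ x, |Qc 1 x - Q₂ x| ≤ ε) ∧
          ∃ (f : (Fin ⌊t * (n : ℝ)⌋₊ → V) → Fin n → X)
            (φ : (Fin n → Y) → Fin ⌊t * (n : ℝ)⌋₊ → V),
            (∀ v, f v ∈ typeClass n (Qc (cls v))) ∧
            ENNReal.ofReal (pErr PV W f φ) ≤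
              EReal.exp (-(n : EReal) * (EJ2ex PV W t - (ε : EReal))) := by
  have hV : Nonempty V := by
    by_contra hcon
    rw [not_nonempty_iff] at hcon
    have := hPV.2
    simp at this
  obtain ⟨Q, hQmem, hQ⟩ := exists_limit_pair PV hW ht
  refine ⟨Q 0, hQmem 0, Q 1, hQmem 1, fun ε hε => ?_⟩
  obtain ⟨L, hL⟩ := exists_forall_unionBound_eq_zero hPV W t
  obtain ⟨M, hM, hfin⟩ : ∃ M : ℝ, (M : EReal) < EJ2ex PV W t ∧ ∀ n : ℕ, 0 < n → ∀ u v : ℝ,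
      u ≤ v → v ≤ Real.exp (-(n * (M - ε / 2))) → (v < Real.exp (-(n * L)) → v ≤ 0) →
      ENNReal.ofReal u ≤ EReal.exp (-(n : EReal) * (EJ2ex PV W t - (ε : EReal))) := by
    obtain ⟨M₀, hM₀⟩ := exists_real_lt_EJ2ex PV hW ht
    generalize EJ2ex PV W t = E at hM₀ ⊢
    induction E with
    | bot => exact absurd hM₀ not_lt_bot
    | coe E =>
      refine ⟨E - ε / 2, EReal.coe_lt_coe_iff.2 (by linarith), fun n hn u v huv hv _ => ?_⟩
      have he : -(n : EReal) * ((E : EReal) - (ε : EReal)) =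
          ((-(n * (E - ε)) : ℝ) : EReal) := by
        rw [← neg_mul]; push_cast; rfl
      rw [he, EReal.exp_coe]
      refine ENNReal.ofReal_le_ofReal (huv.trans (hv.trans (le_of_eq ?_)))
      congr 1
      ring
    | top =>
      refine ⟨L + 1 + ε / 2, EReal.coe_lt_top _, fun n hn u v huv hv hz => ?_⟩
      have hn' : (0 : ℝ) < n := by exact_mod_cast hn
      have h0 : v ≤ 0 := hz (hv.trans_lt (Real.exp_lt_exp.2 (by nlinarith)))
      rw [ENNReal.ofReal_of_nonpos (huv.trans h0)]
      exact zero_le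
  obtain ⟨Q', ρ, A, R, hgood, hnear⟩ := hQ M hM (ε / 2) (by positivity)
  obtain ⟨n₀, hn₀⟩ := Filter.eventually_atTop.1
    (hgood.eventually_exists_code hPV.1 hW ht (half_pos hε) (half_pos hε))
  refine ⟨max n₀ 1, fun n hn => ?_⟩
  obtain ⟨cls, Qc, hpart, hne, hclose, f, φ, hf, hφ, hU⟩ := hn₀ n ((le_max_left _ _).trans hn)
  have hclose' : ∀ c x, |Qc c x - Q c x| ≤ ε := fun c x => by
    calc |Qc c x - Q c x| ≤ |Qc c x - Q' c x| + |Q' c x - Q c x| := abs_sub_le _ _ _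
      _ ≤ ε / 2 + ε / 2 := add_le_add (hclose c x) (hnear c x)
      _ = ε := by ring
  exact ⟨cls, Qc, hpart, hne, hclose' 0, hclose' 1, f, φ, hf,
    hfin n ((le_max_right _ _).trans hn) _ _ hφ hU (hL (Nat.floor_le (by positivity)) f)⟩
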